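/- Let d ≥ 2, 1 < p < ∞ and C₀ > 0, and let V be a locally bounded measurable function on the punctured unit ball B_1 \ {0} ⊆ ℝ^d satisfying ‖x‖^p |V(x)| ≤ C₀ for almost every x. Then there exists a constant C > 0, depending only on d, p and C₀, such that for every pair u, v of positive C¹ weak solutions of -Δ_p w + V|w|^{p-2}w = 0 in B_1 \ {0} and every 0 < r < 1/2, sup_{x ∈ A_r} u(x)/v(x) ≤ C · inf_{x ∈ A_r} u(x)/v(x), where A_r := { x : r/2 < ‖x‖ < r }. -/

import Mathlib

open MeasureTheory Metric Filter Topology Set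
open scoped RealInnerProductSpace

noncomputable section

/-- `u` is a positive `C¹` weak solution of `-Δ_p u + V|u|^{p-2}u = 0` in the open set `Ω`. -/
def IsPosWeakSol {d : ℕ} (p : ℝ) (V : EuclideanSpace ℝ (Fin d) → ℝ)
    (Ω : Set (EuclideanSpace ℝ (Fin d))) (u : EuclideanSpace ℝ (Fin d) → ℝ) : Prop :=
  ContDiffOn ℝ 1 u Ω ∧ (∀ x ∈ Ω, 0 < u x) ∧
  ∀ φ : EuclideanSpace ℝ (Fin d) → ℝ, ContDiff ℝ (⊤ : ℕ∞) φ → HasCompactSupport φ →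
    tsupport φ ⊆ Ω →
    ∫ x in Ω, (‖gradient u x‖ ^ (p - 2) * ⟪gradient u x, gradient φ x⟫ +
      V x * |u x| ^ (p - 2) * u x * φ x) = 0

section Mollification

variable {E : Type*} [NormedAddCommGroup E] [InnerProductSpace ℝ E] [FiniteDimensional ℝ E]
  [MeasurableSpace E] [BorelSpace E]

/-- A compactly supported `C¹` function is approximated in `C¹` by smooth functions supported
nearby. -/
theorem exists_smooth_approx_C1 {φ : E → ℝ} (hφ : ContDiff ℝ 1 φ) (hc : HasCompactSupport φ)
    {δ : ℝ} (hδ : 0 < δ) :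
    ∃ g : E → ℝ, ContDiff ℝ (⊤ : ℕ∞) g ∧ tsupport g ⊆ cthickening δ (tsupport φ) ∧
      (∀ x, |g x - φ x| ≤ δ) ∧ ∀ x, ‖fderiv ℝ g x - fderiv ℝ φ x‖ ≤ δ := by
  obtain ⟨δ₁, hδ₁, h1⟩ := Metric.uniformContinuous_iff.mp
    (hφ.continuous.uniformContinuous_of_tendsto_cocompact
      (hc.is_zero_at_infty)) δ hδ
  obtain ⟨δ₂, hδ₂, h2⟩ := Metric.uniformContinuous_iff.mp
    ((hφ.continuous_fderiv one_ne_zero).uniformContinuous_of_tendsto_cocompact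
      ((hc.fderiv ℝ).is_zero_at_infty)) δ hδ
  set ε := min δ (min δ₁ δ₂) with hε
  have hε0 : 0 < ε := by positivity
  let b : ContDiffBump (0 : E) := ⟨ε / 2, ε, half_pos hε0, half_lt_self hε0⟩
  have hbl : LocallyIntegrable (b.normed volume) volume :=
    (b.continuous_normed).locallyIntegrable
  let g : E → ℝ := convolution (b.normed volume) φ (ContinuousLinearMap.lsmul ℝ ℝ) volume
  have hder : ∀ x, fderiv ℝ g x =
      convolution (b.normed volume) (fderiv ℝ φ) (ContinuousLinearMap.lsmul ℝ ℝ) volume x := by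
    intro x
    rw [(hc.hasFDerivAt_convolution_right (ContinuousLinearMap.lsmul ℝ ℝ) hbl hφ x).fderiv]
    rfl
  refine ⟨g, ?_, ?_, ?_, ?_⟩
  · exact b.hasCompactSupport_normed.contDiff_convolution_left _ b.contDiff_normed
      hφ.continuous.locallyIntegrable
  · refine closure_minimal ?_ isClosed_cthickening
    intro x hx
    by_contra hxn
    apply hx
    have hz : ∀ y ∈ ball x ε, φ y = 0 := by
      intro y hy
      by_contra hy0
      apply hxn
      refine mem_cthickening_of_dist_le x y δ _ (subset_tsupport _ hy0) ?_
      rw [dist_comm]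
      exact (mem_ball.1 hy).le.trans (min_le_left _ _)
    have := b.dist_normed_convolution_le (μ := volume) (ε := 0) (x₀ := x) (g := φ)
      hφ.continuous.aestronglyMeasurable (fun y hy => by
        rw [hz y hy, hz x (mem_ball_self hε0), dist_self])
    rw [hz x (mem_ball_self hε0)] at this
    exact dist_le_zero.1 this
  · intro x
    rw [← Real.dist_eq]
    refine b.dist_normed_convolution_le (μ := volume) hφ.continuous.aestronglyMeasurable
      (fun y hy => (h1 ?_).le)
    exact (mem_ball.1 hy).trans_le ((min_le_right _ _).trans (min_le_left _ _))
  · intro x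
    rw [hder, ← dist_eq_norm]
    refine b.dist_normed_convolution_le (μ := volume)
      (hφ.continuous_fderiv one_ne_zero).aestronglyMeasurable
      (fun y hy => (h2 ?_).le)
    exact (mem_ball.1 hy).trans_le ((min_le_right _ _).trans (min_le_right _ _))

theorem integral_fderiv_add_eq_zero_of_smooth {Ω : Set E} (hΩ : IsOpen Ω) {F : E → E} {G : E → ℝ}
    (hF : AEStronglyMeasurable F (volume.restrict Ω))
    (hG : AEStronglyMeasurable G (volume.restrict Ω))
    (hFb : ∀ K, IsCompact K → K ⊆ Ω → ∃ M : ℝ, ∀ x ∈ K, ‖F x‖ ≤ M)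
    (hGb : ∀ K, IsCompact K → K ⊆ Ω → ∃ M : ℝ, ∀ x ∈ K, |G x| ≤ M)
    (h : ∀ φ : E → ℝ, ContDiff ℝ (⊤ : ℕ∞) φ → HasCompactSupport φ → tsupport φ ⊆ Ω →
      ∫ x in Ω, (fderiv ℝ φ x (F x) + G x * φ x) = 0)
    {φ : E → ℝ} (hφ : ContDiff ℝ 1 φ) (hc : HasCompactSupport φ) (hs : tsupport φ ⊆ Ω) :
    ∫ x in Ω, (fderiv ℝ φ x (F x) + G x * φ x) = 0 := by
  obtain ⟨δ, hδ, hδΩ⟩ := hc.isCompact.exists_cthickening_subset_open hΩ hs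
  set K := cthickening δ (tsupport φ) with hK
  have hKc : IsCompact K := hc.isCompact.cthickening
  obtain ⟨MF, hMF⟩ := hFb K hKc hδΩ
  obtain ⟨MG, hMG⟩ := hGb K hKc hδΩ
  have hδn : ∀ n : ℕ, 0 < δ / (n + 1) := fun n => by positivity
  choose g hg1 hg2 hg3 hg4 using fun n : ℕ => exists_smooth_approx_C1 hφ hc (hδn n)
  have hδle : ∀ n : ℕ, δ / (n + 1) ≤ δ := fun n => div_le_self hδ.le (by simp)
  have hgs : ∀ n, tsupport (g n) ⊆ K := fun n => (hg2 n).trans (cthickening_mono (hδle n) _)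
  have hδlim : Tendsto (fun n : ℕ => δ / (n + 1)) atTop (𝓝 0) := by
    exact tendsto_const_nhds.div_atTop
      (tendsto_natCast_atTop_atTop.atTop_add tendsto_const_nhds)
  obtain ⟨Mφ, hMφ⟩ := hφ.continuous.bounded_above_of_compact_support hc
  obtain ⟨Mφ', hMφ'⟩ := (hφ.continuous_fderiv one_ne_zero).bounded_above_of_compact_support
    (hc.fderiv ℝ)
  have hzero : ∀ n, ∫ x in Ω, (fderiv ℝ (g n) x (F x) + G x * g n x) = 0 := fun n =>
    h (g n) (hg1 n) (hKc.of_isClosed_subset (isClosed_tsupport _) (hgs n)) ((hgs n).trans hδΩ)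
  have hlim : Tendsto (fun n => ∫ x in Ω, (fderiv ℝ (g n) x (F x) + G x * g n x)) atTop
      (𝓝 (∫ x in Ω, (fderiv ℝ φ x (F x) + G x * φ x))) := by
    refine tendsto_integral_of_dominated_convergence
      (K.indicator fun _ => (δ + Mφ') * MF + MG * (δ + Mφ)) ?_ ?_ ?_ ?_
    · intro n
      have h1 : AEStronglyMeasurable (fun x => fderiv ℝ (g n) x (F x)) (volume.restrict Ω) := by
        have := (((hg1 n).continuous_fderiv (by simp)).aestronglyMeasurable
          (μ := volume.restrict Ω)).prodMk hF
        exact isBoundedBilinearMap_apply.continuous.comp_aestronglyMeasurable this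
      exact h1.add (hG.mul (hg1 n).continuous.aestronglyMeasurable)
    · refine IntegrableOn.integrable ?_
      refine (integrable_indicator_iff hKc.isClosed.measurableSet).2 ?_ |>.restrict
      exact integrableOn_const hKc.measure_lt_top.ne
    · intro n
      filter_upwards with x
      by_cases hx : x ∈ K
      · rw [indicator_of_mem hx]
        have a1 : ‖fderiv ℝ (g n) x‖ ≤ δ + Mφ' := by
          have := norm_add_le (fderiv ℝ (g n) x - fderiv ℝ φ x) (fderiv ℝ φ x)
          rw [sub_add_cancel] at this
          linarith [hg4 n x, hMφ' x, hδle n]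
        have a2 : |g n x| ≤ δ + Mφ := by
          have := abs_add_le (g n x - φ x) (φ x)
          rw [sub_add_cancel] at this
          have := hMφ x
          rw [Real.norm_eq_abs] at this
          linarith [hg3 n x, hδle n]
        refine (norm_add_le _ _).trans (add_le_add ?_ ?_)
        · refine ((fderiv ℝ (g n) x).le_opNorm _).trans ?_
          exact mul_le_mul a1 (hMF x hx) (norm_nonneg _) ((norm_nonneg _).trans a1)
        · rw [norm_mul, Real.norm_eq_abs, Real.norm_eq_abs]
          exact mul_le_mul (hMG x hx) a2 (abs_nonneg _) ((abs_nonneg _).trans (hMG x hx))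
      · rw [indicator_of_notMem hx]
        have h1 : g n x = 0 := image_eq_zero_of_notMem_tsupport fun h => hx (hgs n h)
        have h2 : fderiv ℝ (g n) x = 0 := by
          by_contra h
          exact hx (hgs n (support_fderiv_subset ℝ h))
        simp [h1, h2]
    · filter_upwards with x
      have t1 : Tendsto (fun n => g n x) atTop (𝓝 (φ x)) := by
        rw [tendsto_iff_dist_tendsto_zero]
        exact squeeze_zero (fun _ => dist_nonneg) (fun n => hg3 n x) hδlim
      have t2 : Tendsto (fun n => fderiv ℝ (g n) x) atTop (𝓝 (fderiv ℝ φ x)) := by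
        rw [tendsto_iff_norm_sub_tendsto_zero]
        exact squeeze_zero (fun _ => norm_nonneg _) (fun n => hg4 n x) hδlim
      have t3 : Tendsto (fun n => fderiv ℝ (g n) x (F x)) atTop (𝓝 (fderiv ℝ φ x (F x))) :=
        ((ContinuousLinearMap.apply ℝ ℝ (F x)).continuous.tendsto _).comp t2
      exact t3.add (t1.const_mul _)
  simp only [hzero] at hlim
  exact (tendsto_nhds_unique hlim tendsto_const_nhds)

end Mollification

section LogSolution

variable {d : ℕ} {p : ℝ} {V u : EuclideanSpace ℝ (Fin d) → ℝ} {Ω : Set (EuclideanSpace ℝ (Fin d))}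

theorem contDiff_of_contDiffAt_tsupport {E : Type*} [NormedAddCommGroup E] [NormedSpace ℝ E]
    {n : WithTop ℕ∞} {f : E → ℝ} (h : ∀ x ∈ tsupport f, ContDiffAt ℝ n f x) : ContDiff ℝ n f := by
  refine contDiff_iff_contDiffAt.2 fun x => ?_
  by_cases hx : x ∈ tsupport f
  · exact h x hx
  · exact (contDiffAt_const (c := (0 : ℝ))).congr_of_eventuallyEq
      (notMem_tsupport_iff_eventuallyEq.1 hx)

theorem measurable_gradient (f : EuclideanSpace ℝ (Fin d) → ℝ) : Measurable (gradient f) :=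
  (InnerProductSpace.toDual ℝ _).symm.continuous.measurable.comp (measurable_fderiv ℝ f)

theorem norm_gradient (f : EuclideanSpace ℝ (Fin d) → ℝ) (x : EuclideanSpace ℝ (Fin d)) :
    ‖gradient f x‖ = ‖fderiv ℝ f x‖ := by
  simp [gradient]

theorem continuous_gradient {f : EuclideanSpace ℝ (Fin d) → ℝ} (hf : ContDiff ℝ 1 f) :
    Continuous (gradient f) :=
  (InnerProductSpace.toDual ℝ _).symm.continuous.comp (hf.continuous_fderiv one_ne_zero)

theorem rpow_sub_two_mul_sq {a : ℝ} (ha : 0 ≤ a) (hp : 1 < p) : a ^ (p - 2) * a ^ 2 = a ^ p := by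
  rcases ha.eq_or_lt with rfl | ha
  · simp [Real.zero_rpow (by linarith : p ≠ 0)]
  · rw [← Real.rpow_natCast, ← Real.rpow_add ha]
    norm_num

theorem rpow_sub_two_mul_self {a : ℝ} (ha : 0 ≤ a) (hp : 1 < p) :
    a ^ (p - 2) * a = a ^ (p - 1) := by
  rcases ha.eq_or_lt with rfl | ha
  · simp [Real.zero_rpow (by linarith : p - 1 ≠ 0)]
  · nth_rewrite 2 [← Real.rpow_one a]
    rw [← Real.rpow_add ha]
    ring_nf

theorem IsPosWeakSol.integral_C1 (hΩ : IsOpen Ω) (hp : 1 < p) (hV : Measurable V)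
    (hVb : ∀ K, IsCompact K → K ⊆ Ω → ∃ M : ℝ, ∀ x ∈ K, |V x| ≤ M) (hu : IsPosWeakSol p V Ω u)
    {φ : EuclideanSpace ℝ (Fin d) → ℝ} (hφ : ContDiff ℝ 1 φ) (hc : HasCompactSupport φ)
    (hs : tsupport φ ⊆ Ω) :
    ∫ x in Ω, (‖gradient u x‖ ^ (p - 2) * fderiv ℝ φ x (gradient u x) +
      V x * u x ^ (p - 1) * φ x) = 0 := by
  obtain ⟨hu1, hpos, hw⟩ := hu
  have hgc : ContinuousOn (gradient u) Ω :=
    (InnerProductSpace.toDual ℝ _).symm.continuous.comp_continuousOn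
      (hu1.continuousOn_fderiv_of_isOpen hΩ le_rfl)
  have key := integral_fderiv_add_eq_zero_of_smooth hΩ
    (F := fun x => ‖gradient u x‖ ^ (p - 2) • gradient u x)
    (G := fun x => V x * u x ^ (p - 1)) ?_ ?_ ?_ ?_ ?_ hφ hc hs
  · simpa using key
  · have hm := measurable_gradient u
    exact ((hm.norm.pow_const _).smul hm).aestronglyMeasurable
  · refine hV.aestronglyMeasurable.mul ?_
    exact (hu1.continuousOn.rpow_const fun x hx => Or.inl (hpos x hx).ne').aestronglyMeasurable
      hΩ.measurableSet
  · intro K hK hKΩ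
    have hcont : ContinuousOn (fun x => ‖gradient u x‖ ^ (p - 1)) K :=
      ((hgc.mono hKΩ).norm).rpow_const fun x hx => Or.inr (by linarith)
    obtain ⟨M, hM⟩ := hK.exists_bound_of_continuousOn hcont
    refine ⟨M, fun x hx => ?_⟩
    have := hM x hx
    rw [norm_smul, Real.norm_eq_abs, abs_of_nonneg (by positivity),
      rpow_sub_two_mul_self (norm_nonneg _) hp]
    exact (le_abs_self _).trans this
  · intro K hK hKΩ
    have hcont : ContinuousOn (fun x => u x ^ (p - 1)) K :=
      (hu1.continuousOn.mono hKΩ).rpow_const fun x hx => Or.inl (hpos x (hKΩ hx)).ne'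
    obtain ⟨M, hM⟩ := hK.exists_bound_of_continuousOn hcont
    obtain ⟨M', hM'⟩ := hVb K hK hKΩ
    refine ⟨M' * M, fun x hx => ?_⟩
    rw [abs_mul]
    exact mul_le_mul (hM' x hx) (hM x hx) (abs_nonneg _) ((abs_nonneg _).trans (hM' x hx))
  · intro ψ h1 h2 h3
    rw [← hw ψ h1 h2 h3]
    refine setIntegral_congr_fun hΩ.measurableSet fun x hx => ?_
    have hp0 := hpos x hx
    simp only [map_smul, smul_eq_mul]
    rw [real_inner_comm, inner_gradient_left, abs_of_pos hp0,
      ← rpow_sub_two_mul_self hp0.le hp]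
    ring

theorem IsPosWeakSol.log_eq (hΩ : IsOpen Ω) (hp : 1 < p) (hV : Measurable V)
    (hVb : ∀ K, IsCompact K → K ⊆ Ω → ∃ M : ℝ, ∀ x ∈ K, |V x| ≤ M) (hu : IsPosWeakSol p V Ω u)
    {w : EuclideanSpace ℝ (Fin d) → ℝ} (hwu : ∀ x, w x = Real.log (u x))
    {ψ : EuclideanSpace ℝ (Fin d) → ℝ} (hψ : ContDiff ℝ 1 ψ) (hc : HasCompactSupport ψ)
    (hs : tsupport ψ ⊆ Ω) :
    ∫ x in Ω, ((‖gradient w x‖ ^ (p - 2) * fderiv ℝ ψ x (gradient w x) -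
      (p - 1) * ‖gradient w x‖ ^ p * ψ x) + V x * ψ x) = 0 := by
  have hu1 := hu.1
  have hpos := hu.2.1
  have huat : ∀ x ∈ Ω, ContDiffAt ℝ 1 u x := fun x hx => hu1.contDiffAt (hΩ.mem_nhds hx)
  set φ : EuclideanSpace ℝ (Fin d) → ℝ := fun x => ψ x * u x ^ (1 - p) with hφdef
  have hsub : tsupport φ ⊆ tsupport ψ := tsupport_mul_subset_left
  have hφ : ContDiff ℝ 1 φ := by
    refine contDiff_of_contDiffAt_tsupport fun x hx => ?_
    have hxΩ := hs (hsub hx)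
    exact hψ.contDiffAt.mul ((huat x hxΩ).rpow_const_of_ne (hpos x hxΩ).ne')
  have hcφ : HasCompactSupport φ := hc.mul_right
  rw [← hu.integral_C1 hΩ hp hV hVb hφ hcφ (hsub.trans hs)]
  refine setIntegral_congr_fun hΩ.measurableSet fun x hx => ?_
  have hp0 := hpos x hx
  have hdu : HasFDerivAt u (fderiv ℝ u x) x :=
    ((huat x hx).differentiableAt one_ne_zero).hasFDerivAt
  have hdψ : HasFDerivAt ψ (fderiv ℝ ψ x) x := (hψ.differentiable one_ne_zero x).hasFDerivAt
  have hdφ := (hdψ.mul (hdu.rpow_const (p := 1 - p) (Or.inl hp0.ne'))).fderiv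
  have hw : gradient w x = (u x)⁻¹ • gradient u x := by
    have : w = fun x => Real.log (u x) := funext hwu
    rw [this, gradient, (hdu.log hp0.ne').fderiv]
    simp [gradient]
  have hgu : gradient u x = u x • gradient w x := by
    rw [hw, smul_smul, mul_inv_cancel₀ hp0.ne', one_smul]
  have hDu : fderiv ℝ u x (gradient w x) = u x * ‖gradient w x‖ ^ 2 := by
    rw [← inner_gradient_left, hgu, real_inner_smul_left, real_inner_self_eq_norm_sq]
  have hdφ' : fderiv ℝ φ x (gradient u x) = u x ^ (2 - p) *
      (fderiv ℝ ψ x (gradient w x) + (1 - p) * ψ x * ‖gradient w x‖ ^ 2) := by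
    have e1 : u x ^ (1 - p) * u x = u x ^ (2 - p) := by
      nth_rewrite 2 [← Real.rpow_one (u x)]
      rw [← Real.rpow_add hp0]; ring_nf
    have e2 : u x ^ (1 - p - 1) * u x = u x ^ (1 - p) := by
      nth_rewrite 2 [← Real.rpow_one (u x)]
      rw [← Real.rpow_add hp0]; ring_nf
    rw [hgu, map_smul, hφdef]
    erw [hdφ]
    simp only [add_apply, smul_apply, smul_eq_mul, hDu]
    rw [← e1, ← e2]
    ring
  have hn : ‖gradient u x‖ ^ (p - 2) = u x ^ (p - 2) * ‖gradient w x‖ ^ (p - 2) := by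
    rw [hgu, norm_smul, Real.norm_eq_abs, abs_of_pos hp0, Real.mul_rpow hp0.le (norm_nonneg _)]
  have e3 : u x ^ (p - 2) * u x ^ (2 - p) = 1 := by
    rw [← Real.rpow_add hp0]; simp
  have e4 : u x ^ (p - 1) * u x ^ (1 - p) = 1 := by
    rw [← Real.rpow_add hp0]; simp
  beta_reduce
  rw [hdφ', hn, ← rpow_sub_two_mul_sq (norm_nonneg (gradient w x)) hp]
  have : V x * u x ^ (p - 1) * φ x = V x * ψ x := by
    rw [hφdef]
    linear_combination V x * ψ x * e4
  rw [this]
  linear_combination (-‖gradient w x‖ ^ (p - 2) *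
    (fderiv ℝ ψ x (gradient w x) + (1 - p) * ψ x * ‖gradient w x‖ ^ 2)) * e3

end LogSolution

/-- The two-sided integral inequality satisfied in the unit ball by the logarithm `w` of a positive
solution whose potential is bounded by `Λ`. -/
def IsLogSol {d : ℕ} (p Λ : ℝ) (w : EuclideanSpace ℝ (Fin d) → ℝ) : Prop :=
  ContDiff ℝ 1 w ∧ ∀ ψ : EuclideanSpace ℝ (Fin d) → ℝ, ContDiff ℝ 1 ψ →
    (∀ x, 1 ≤ ‖x‖ → ψ x = 0) → (∀ x, 0 ≤ ψ x) →
    |∫ x, (‖gradient w x‖ ^ (p - 2) * fderiv ℝ ψ x (gradient w x) -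
      (p - 1) * ‖gradient w x‖ ^ p * ψ x)| ≤ Λ * ∫ x, ψ x

section Rescaling

variable {d : ℕ} {p : ℝ} {V u : EuclideanSpace ℝ (Fin d) → ℝ}

theorem tsupport_subset_closedBall_of_eq_zero {ψ : EuclideanSpace ℝ (Fin d) → ℝ} {R : ℝ}
    (h0 : ∀ x, R ≤ ‖x‖ → ψ x = 0) : tsupport ψ ⊆ closedBall 0 R := by
  refine closure_minimal (fun x hx => ?_) isClosed_closedBall
  rw [mem_closedBall_zero_iff]
  by_contra h
  exact hx (h0 x (not_le.1 h).le)

theorem IsPosWeakSol.abs_integral_le {Ω : Set (EuclideanSpace ℝ (Fin d))} (hΩ : IsOpen Ω)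
    (hp : 1 < p) (hV : Measurable V)
    (hVb : ∀ K, IsCompact K → K ⊆ Ω → ∃ M : ℝ, ∀ x ∈ K, |V x| ≤ M) (hu : IsPosWeakSol p V Ω u)
    {w : EuclideanSpace ℝ (Fin d) → ℝ} (hwu : ∀ x, w x = Real.log (u x))
    {ψ : EuclideanSpace ℝ (Fin d) → ℝ} (hψ : ContDiff ℝ 1 ψ) (hc : HasCompactSupport ψ)
    (hs : tsupport ψ ⊆ Ω) {L : ℝ}
    (hVL : ∀ᵐ x ∂volume.restrict Ω, |V x * ψ x| ≤ L * ψ x) :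
    |∫ x, (‖gradient w x‖ ^ (p - 2) * fderiv ℝ ψ x (gradient w x) -
      (p - 1) * ‖gradient w x‖ ^ p * ψ x)| ≤ L * ∫ x, ψ x := by
  have hlog := hu.log_eq hΩ hp hV hVb hwu hψ hc hs
  have hψi : Integrable ψ := hψ.continuous.integrable_of_hasCompactSupport hc
  have hout : ∀ x, x ∉ Ω → ψ x = 0 ∧ fderiv ℝ ψ x = 0 := fun x hx =>
    ⟨image_eq_zero_of_notMem_tsupport fun h => hx (hs h), by
      by_contra h
      exact hx (hs (support_fderiv_subset ℝ h))⟩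
  have eA := setIntegral_eq_integral_of_forall_compl_eq_zero (μ := volume) (s := Ω)
    (f := fun x => ‖gradient w x‖ ^ (p - 2) * fderiv ℝ ψ x (gradient w x) -
      (p - 1) * ‖gradient w x‖ ^ p * ψ x) (fun x hx => by simp [hout x hx])
  have eψ := setIntegral_eq_integral_of_forall_compl_eq_zero (μ := volume) (s := Ω)
    (f := ψ) (fun x hx => by simp [hout x hx])
  have hVi : Integrable (fun x => V x * ψ x) (volume.restrict Ω) :=
    (hψi.restrict.const_mul L).mono'
      (hV.aestronglyMeasurable.mul hψ.continuous.aestronglyMeasurable) hVL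
  have hbound : |∫ x in Ω, V x * ψ x| ≤ L * ∫ x, ψ x := by
    rw [← eψ, ← integral_const_mul]
    exact norm_integral_le_of_norm_le (f := fun x => V x * ψ x) (hψi.restrict.const_mul L) hVL
  rw [← eA]
  by_cases hAi : Integrable (fun x => ‖gradient w x‖ ^ (p - 2) * fderiv ℝ ψ x (gradient w x) -
      (p - 1) * ‖gradient w x‖ ^ p * ψ x) (volume.restrict Ω)
  · rw [integral_add hAi hVi] at hlog
    rw [eq_neg_of_add_eq_zero_left hlog, abs_neg]
    exact hbound
  · rw [integral_undef hAi, abs_zero]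
    exact (abs_nonneg _).trans hbound

theorem integral_comp_affine (f : EuclideanSpace ℝ (Fin d) → ℝ) (a : EuclideanSpace ℝ (Fin d))
    {ρ : ℝ} (hρ : 0 < ρ) : ∫ x, f (a + ρ • x) = (ρ ^ d)⁻¹ * ∫ x, f x := by
  rw [Measure.integral_comp_smul_of_nonneg volume (fun x => f (a + x)) ρ (hR := hρ.le),
    integral_add_left_eq_self, finrank_euclideanSpace_fin, smul_eq_mul]

theorem IsPosWeakSol.exists_isLogSol (hp : 1 < p) {C₀ : ℝ} (hV : Measurable V)
    (hVb : ∀ K : Set (EuclideanSpace ℝ (Fin d)), IsCompact K →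
      K ⊆ ball (0 : EuclideanSpace ℝ (Fin d)) 1 \ {0} → ∃ M : ℝ, ∀ x ∈ K, |V x| ≤ M)
    (hVC : ∀ᵐ x ∂(volume.restrict (ball (0 : EuclideanSpace ℝ (Fin d)) 1 \ {0})),
      ‖x‖ ^ p * |V x| ≤ C₀)
    (hu : IsPosWeakSol p V (ball (0 : EuclideanSpace ℝ (Fin d)) 1 \ {0}) u)
    {a : EuclideanSpace ℝ (Fin d)} (ha0 : 0 < ‖a‖) (ha : ‖a‖ < 1 / 2) :
    ∃ w : EuclideanSpace ℝ (Fin d) → ℝ, IsLogSol p C₀ w ∧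
      ∀ x, ‖x‖ ≤ 1 → w x = Real.log (u (a + (‖a‖ / 2) • x)) := by
  set Ω := ball (0 : EuclideanSpace ℝ (Fin d)) 1 \ {0} with hΩdef
  have hΩ : IsOpen Ω := isOpen_ball.sdiff isClosed_singleton
  set ρ := ‖a‖ / 2 with hρdef
  have hρ : 0 < ρ := by positivity
  have hmem : ∀ x : EuclideanSpace ℝ (Fin d), ‖x‖ ≤ 3 / 2 → a + ρ • x ∈ Ω := by
    intro x hx
    have h1 : ‖ρ • x‖ ≤ ρ * (3 / 2) := by
      rw [norm_smul, Real.norm_eq_abs, abs_of_pos hρ]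
      gcongr
    have h2 := norm_add_le a (ρ • x)
    have h3 := norm_sub_le (a + ρ • x) (ρ • x)
    rw [add_sub_cancel_right] at h3
    refine ⟨?_, ?_⟩
    · rw [mem_ball_zero_iff]; linarith
    · rw [mem_singleton_iff, ← norm_eq_zero]
      intro h
      linarith
  let χ : ContDiffBump (0 : EuclideanSpace ℝ (Fin d)) := ⟨5 / 4, 3 / 2, by norm_num, by norm_num⟩
  set W : EuclideanSpace ℝ (Fin d) → ℝ := fun x => Real.log (u x) with hW
  set w : EuclideanSpace ℝ (Fin d) → ℝ := fun x => χ x * W (a + ρ • x) with hw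
  have hWd : ∀ x ∈ Ω, ContDiffAt ℝ 1 W x := fun x hx =>
    (hu.1.contDiffAt (hΩ.mem_nhds hx)).log (hu.2.1 x hx).ne'
  have hw1 : ContDiff ℝ 1 w := by
    refine contDiff_of_contDiffAt_tsupport fun x hx => ?_
    have hx' : ‖x‖ ≤ 3 / 2 := by
      have := tsupport_mul_subset_left hx
      rw [χ.tsupport_eq] at this
      simpa using this
    refine χ.contDiffAt.mul ?_
    exact ContDiffAt.comp (g := W) (f := fun x => a + ρ • x) x (hWd _ (hmem x hx')) (by fun_prop)
  have hweq : ∀ x, ‖x‖ ≤ 5 / 4 → w x = W (a + ρ • x) := by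
    intro x hx
    simp only [hw]
    rw [χ.one_of_mem_closedBall (by simpa using hx), one_mul]
  refine ⟨w, ⟨hw1, fun ψ hψ h0 hnn => ?_⟩, fun x hx => hweq x (by linarith)⟩
  set Ψ : EuclideanSpace ℝ (Fin d) → ℝ := fun y => ψ (ρ⁻¹ • (y - a)) with hΨ
  have hΨ1 : ContDiff ℝ 1 Ψ := hψ.comp (by fun_prop)
  have hΨeq : ∀ x, Ψ (a + ρ • x) = ψ x := by
    intro x
    simp [hΨ, smul_smul, inv_mul_cancel₀ hρ.ne']
  have hΨ0 : ∀ y, ρ ≤ ‖y - a‖ → Ψ y = 0 := by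
    intro y hy
    refine h0 _ ?_
    rw [norm_smul, norm_inv, Real.norm_eq_abs, abs_of_pos hρ, inv_mul_eq_div]
    exact (one_le_div hρ).2 hy
  have hts : tsupport Ψ ⊆ closedBall a ρ := by
    refine closure_minimal (fun x hx => ?_) isClosed_closedBall
    rw [mem_closedBall, dist_eq_norm]
    by_contra h
    exact hx (hΨ0 x (not_le.1 h).le)
  have hcΨ : HasCompactSupport Ψ :=
    (isCompact_closedBall a ρ).of_isClosed_subset (isClosed_tsupport _) hts
  have htsΩ : tsupport Ψ ⊆ Ω := by
    intro y hy
    have h1 := hts hy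
    rw [mem_closedBall, dist_eq_norm] at h1
    have h2 := hmem (ρ⁻¹ • (y - a)) (by
      rw [norm_smul, norm_inv, Real.norm_eq_abs, abs_of_pos hρ, inv_mul_eq_div]
      have := (div_le_one hρ).2 h1
      linarith)
    rwa [smul_smul, mul_inv_cancel₀ hρ.ne', one_smul, add_sub_cancel] at h2
  have hρp : 0 < ρ ^ p := Real.rpow_pos_of_pos hρ p
  have hVL : ∀ᵐ x ∂volume.restrict Ω, |V x * Ψ x| ≤ C₀ * (ρ ^ p)⁻¹ * Ψ x := by
    filter_upwards [hVC] with y hy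
    have hΨnn : 0 ≤ Ψ y := hnn _
    rcases le_or_gt ρ ‖y - a‖ with h | h
    · simp [hΨ0 y h]
    · rw [abs_mul, abs_of_nonneg hΨnn]
      refine mul_le_mul_of_nonneg_right ?_ hΨnn
      have h3 := norm_sub_norm_le a y
      rw [norm_sub_rev] at h3
      have h4 : ρ ≤ ‖y‖ := by linarith
      have h5 : ρ ^ p ≤ ‖y‖ ^ p := Real.rpow_le_rpow hρ.le h4 (by linarith)
      rw [← div_eq_mul_inv, le_div_iff₀ hρp, mul_comm]
      exact (mul_le_mul_of_nonneg_right h5 (abs_nonneg _)).trans hy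
  have key := hu.abs_integral_le hΩ hp hV hVb (w := W) (fun _ => rfl) hΨ1 hcΨ htsΩ hVL
  have hA : ∀ x, ‖gradient w x‖ ^ (p - 2) * fderiv ℝ ψ x (gradient w x) -
      (p - 1) * ‖gradient w x‖ ^ p * ψ x = ρ ^ p *
      (‖gradient W (a + ρ • x)‖ ^ (p - 2) *
        fderiv ℝ Ψ (a + ρ • x) (gradient W (a + ρ • x)) -
      (p - 1) * ‖gradient W (a + ρ • x)‖ ^ p * Ψ (a + ρ • x)) := by
    intro x
    have hDΨ : fderiv ℝ ψ x = ρ • fderiv ℝ Ψ (a + ρ • x) := by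
      have h1 : HasFDerivAt (fun x => Ψ (a + ρ • x))
          ((fderiv ℝ Ψ (a + ρ • x)).comp (ρ • ContinuousLinearMap.id ℝ _)) x :=
        (hΨ1.differentiable one_ne_zero _).hasFDerivAt.comp x
          (((hasFDerivAt_id x).const_smul ρ).const_add a)
      have h2 : (fun x => Ψ (a + ρ • x)) = ψ := funext hΨeq
      rw [h2] at h1
      rw [h1.fderiv]
      ext v
      simp
    rcases le_or_gt (5 / 4) ‖x‖ with hx | hx
    · have hxs : x ∉ tsupport ψ := fun h => by
        have := tsupport_subset_closedBall_of_eq_zero h0 h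
        rw [mem_closedBall_zero_iff] at this
        linarith
      have z1 : ψ x = 0 := image_eq_zero_of_notMem_tsupport hxs
      have z2 : fderiv ℝ ψ x = 0 := by
        by_contra h
        exact hxs (support_fderiv_subset ℝ h)
      have z3 : fderiv ℝ Ψ (a + ρ • x) = 0 := by
        rw [hDΨ] at z2
        exact (smul_eq_zero.1 z2).resolve_left hρ.ne'
      simp [z1, z2, z3, hΨeq]
    · have hDw : gradient w x = ρ • gradient W (a + ρ • x) := by
        have h1 : HasFDerivAt (fun x => W (a + ρ • x))
            ((fderiv ℝ W (a + ρ • x)).comp (ρ • ContinuousLinearMap.id ℝ _)) x :=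
          HasFDerivAt.comp (g := W) (f := fun x => a + ρ • x) x
            ((hWd _ (hmem x (by linarith))).differentiableAt one_ne_zero).hasFDerivAt
            (((hasFDerivAt_id x).const_smul ρ).const_add a)
        have h2 : w =ᶠ[𝓝 x] (fun x => W (a + ρ • x)) := by
          filter_upwards [isOpen_ball.mem_nhds (mem_ball_zero_iff.2 hx)] with y hy
          exact hweq y (mem_ball_zero_iff.1 hy).le
        rw [gradient, (h1.congr_of_eventuallyEq h2).fderiv]
        have : (fderiv ℝ W (a + ρ • x)).comp (ρ • ContinuousLinearMap.id ℝ _) =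
            ρ • fderiv ℝ W (a + ρ • x) := by
          ext v; simp
        rw [this]
        simp [gradient]
      have hnn' := norm_nonneg (gradient W (a + ρ • x))
      rw [hDw, hDΨ, norm_smul, Real.norm_eq_abs, abs_of_pos hρ, Real.mul_rpow hρ.le hnn',
        Real.mul_rpow hρ.le hnn', hΨeq, ← rpow_sub_two_mul_sq hρ.le hp]
      simp only [smul_apply, map_smul, smul_eq_mul]
      ring
  have e1 : ∫ x, (‖gradient w x‖ ^ (p - 2) * fderiv ℝ ψ x (gradient w x) -
      (p - 1) * ‖gradient w x‖ ^ p * ψ x) = ρ ^ p * ((ρ ^ d)⁻¹ *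
      ∫ x, (‖gradient W x‖ ^ (p - 2) * fderiv ℝ Ψ x (gradient W x) -
      (p - 1) * ‖gradient W x‖ ^ p * Ψ x)) := by
    rw [← integral_comp_affine _ a hρ, ← integral_const_mul]
    exact integral_congr_ae (Eventually.of_forall hA)
  have e2 : ∫ x, ψ x = (ρ ^ d)⁻¹ * ∫ x, Ψ x := by
    rw [← integral_comp_affine _ a hρ]
    simp only [hΨeq]
  rw [e1, e2, abs_mul, abs_mul, abs_of_pos hρp, abs_of_pos (by positivity : 0 < (ρ ^ d)⁻¹)]
  calc _ ≤ ρ ^ p * ((ρ ^ d)⁻¹ * (C₀ * (ρ ^ p)⁻¹ * ∫ x, Ψ x)) := by gcongr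
    _ = _ := by field_simp

end Rescaling

section Cutoff

variable {p : ℝ}

theorem hasDerivAt_max_zero_rpow (hp : 1 < p) (t : ℝ) :
    HasDerivAt (fun t : ℝ => (max 0 t) ^ p) (p * (max 0 t) ^ (p - 1)) t := by
  rcases lt_trichotomy t 0 with ht | rfl | ht
  · have h : (fun t : ℝ => (max 0 t) ^ p) =ᶠ[𝓝 t] fun _ => 0 := by
      filter_upwards [gt_mem_nhds ht] with s hs
      rw [max_eq_left hs.le, Real.zero_rpow (by linarith)]
    rw [max_eq_left ht.le, Real.zero_rpow (by linarith), mul_zero]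
    exact (hasDerivAt_const t (0 : ℝ)).congr_of_eventuallyEq h
  · rw [max_self, Real.zero_rpow (by linarith), mul_zero]
    rw [hasDerivAt_iff_isLittleO_nhds_zero]
    have h1 : (fun h : ℝ => |h| ^ p) =o[𝓝 0] fun h : ℝ => h := by
      have h2 := (Real.hasDerivAt_rpow_const (x := 0) (p := p) (Or.inr hp.le))
      refine Asymptotics.isLittleO_iff.2 fun c hc => ?_
      have hcont : ContinuousAt (fun h : ℝ => |h| ^ (p - 1)) 0 :=
        (continuous_abs.rpow_const fun _ => Or.inr (by linarith)).continuousAt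
      have hc' : (fun h : ℝ => |h| ^ (p - 1)) 0 < c := by
        simpa [Real.zero_rpow (by linarith : p - 1 ≠ 0)] using hc
      filter_upwards [hcont.eventually_lt continuousAt_const hc'] with h hh
      rcases eq_or_ne h 0 with rfl | h0
      · simp [Real.zero_rpow (by linarith : p ≠ 0)]
      · rw [Real.norm_eq_abs, Real.norm_eq_abs, abs_of_nonneg (by positivity)]
        have : |h| ^ p = |h| ^ (p - 1) * |h| := by
          nth_rewrite 3 [← Real.rpow_one |h|]
          rw [← Real.rpow_add (abs_pos.2 h0)]; ring_nf
        rw [this]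
        gcongr
    refine Asymptotics.IsBigO.trans_isLittleO (Asymptotics.IsBigO.of_bound 1 ?_) h1
    filter_upwards with h
    simp only [zero_add, max_self, Real.zero_rpow (by linarith : p ≠ 0), sub_zero, smul_zero,
      one_mul]
    rw [Real.norm_eq_abs, Real.norm_eq_abs, abs_of_nonneg (by positivity),
      abs_of_nonneg (by positivity)]
    exact Real.rpow_le_rpow (le_max_left _ _) (max_le (abs_nonneg _) (le_abs_self _)) (by linarith)
  · have h : (fun t : ℝ => (max 0 t) ^ p) =ᶠ[𝓝 t] fun t => t ^ p := by
      filter_upwards [lt_mem_nhds ht] with s hs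
      rw [max_eq_right hs.le]
    rw [max_eq_right ht.le]
    exact (Real.hasDerivAt_rpow_const (Or.inl ht.ne')).congr_of_eventuallyEq h

theorem contDiff_max_zero_rpow (hp : 1 < p) : ContDiff ℝ 1 fun t : ℝ => (max 0 t) ^ p := by
  rw [contDiff_one_iff_deriv]
  refine ⟨fun t => (hasDerivAt_max_zero_rpow hp t).differentiableAt, ?_⟩
  have : deriv (fun t : ℝ => (max 0 t) ^ p) = fun t => p * (max 0 t) ^ (p - 1) :=
    funext fun t => (hasDerivAt_max_zero_rpow hp t).deriv
  rw [this]
  exact continuous_const.mul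
    ((continuous_const.max continuous_id).rpow_const fun _ => Or.inr (by linarith))

variable {d : ℕ}

/-- The quadratic profile whose `p`-th power serves as cutoff on the ball of radius `σ`. -/
def ballProfile (σ : ℝ) (x : EuclideanSpace ℝ (Fin d)) : ℝ := max 0 (σ ^ 2 - ‖x‖ ^ 2)

theorem ballProfile_nonneg (σ : ℝ) (x : EuclideanSpace ℝ (Fin d)) : 0 ≤ ballProfile σ x :=
  le_max_left _ _

theorem continuous_ballProfile (σ : ℝ) :
    Continuous (ballProfile σ : EuclideanSpace ℝ (Fin d) → ℝ) := by
  unfold ballProfile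
  fun_prop

theorem ballProfile_le_one {σ : ℝ} (hσ : 0 ≤ σ) (hσ1 : σ ≤ 1) (x : EuclideanSpace ℝ (Fin d)) :
    ballProfile σ x ≤ 1 :=
  max_le zero_le_one (by nlinarith [sq_nonneg ‖x‖])

theorem ballProfile_eq_zero {σ : ℝ} (hσ : 0 ≤ σ) {x : EuclideanSpace ℝ (Fin d)}
    (hx : σ ≤ ‖x‖) : ballProfile σ x = 0 :=
  max_eq_left (by nlinarith)

theorem le_ballProfile {σ τ : ℝ} (hτσ : τ ≤ σ) (hτ : 0 ≤ τ)
    {x : EuclideanSpace ℝ (Fin d)} (hx : ‖x‖ ≤ τ) : (σ - τ) ^ 2 ≤ ballProfile σ x :=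
  le_max_of_le_right (by nlinarith [norm_nonneg x])

theorem contDiff_ballProfile_rpow (hp : 1 < p) (σ : ℝ) :
    ContDiff ℝ 1 fun x : EuclideanSpace ℝ (Fin d) => ballProfile σ x ^ p :=
  (contDiff_max_zero_rpow hp).comp (contDiff_const.sub (contDiff_norm_sq ℝ))

theorem hasFDerivAt_ballProfile_rpow (hp : 1 < p) (σ : ℝ) (x : EuclideanSpace ℝ (Fin d)) :
    HasFDerivAt (fun x : EuclideanSpace ℝ (Fin d) => ballProfile σ x ^ p)
      ((-(2 * p * ballProfile σ x ^ (p - 1))) • innerSL ℝ x) x := by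
  have h1 : HasFDerivAt (fun x : EuclideanSpace ℝ (Fin d) => σ ^ 2 - ‖x‖ ^ 2)
      (-(2 • innerSL ℝ x)) x := (hasStrictFDerivAt_norm_sq x).hasFDerivAt.const_sub _
  have h2 := (hasDerivAt_max_zero_rpow hp (σ ^ 2 - ‖x‖ ^ 2)).comp_hasFDerivAt x h1
  refine h2.congr_fderiv ?_
  ext v
  simp [ballProfile]
  ring

theorem two_mul_rpow_le {δ b : ℝ} (hp : 1 < p) (hδ : 0 < δ) (hb : 0 ≤ b) :
    2 * p * b ^ (p - 1) ≤ δ / 2 * b ^ p + 2 * p * (4 * p / δ) ^ (p - 1) := by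
  have hp0 : 0 < p := by linarith
  have hM : 0 < 4 * p / δ := by positivity
  rcases le_total b (4 * p / δ) with h | h
  · have h1 : b ^ (p - 1) ≤ (4 * p / δ) ^ (p - 1) := Real.rpow_le_rpow hb h (by linarith)
    have h2 : 0 ≤ δ / 2 * b ^ p := by positivity
    nlinarith
  · have hb0 : 0 < b := hM.trans_le h
    have h1 : b ^ p = b ^ (p - 1) * b := by
      nth_rewrite 3 [← Real.rpow_one b]
      rw [← Real.rpow_add hb0]; ring_nf
    have h2 : 4 * p ≤ δ * b := by
      rw [div_le_iff₀ hδ] at h; linarith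
    have h3 : 0 ≤ b ^ (p - 1) := by positivity
    have h4 : 0 ≤ 2 * p * (4 * p / δ) ^ (p - 1) := by positivity
    rw [h1]
    nlinarith [mul_le_mul_of_nonneg_left h2 h3]

end Cutoff

section Caccioppoli

variable {d : ℕ} {p Λ : ℝ} {w : EuclideanSpace ℝ (Fin d) → ℝ}

theorem contDiff_testFunction (hp : 1 < p) (hw : ContDiff ℝ 1 w) (σ q : ℝ) :
    ContDiff ℝ 1 fun x => ballProfile σ x ^ p * Real.exp (q * w x) :=
  (contDiff_ballProfile_rpow hp σ).mul (contDiff_const.mul hw).exp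

theorem fderiv_testFunction (hp : 1 < p) (hw : ContDiff ℝ 1 w) (σ q : ℝ)
    (x : EuclideanSpace ℝ (Fin d)) :
    fderiv ℝ (fun x => ballProfile σ x ^ p * Real.exp (q * w x)) x = Real.exp (q * w x) •
      ((-(2 * p * ballProfile σ x ^ (p - 1))) • innerSL ℝ x +
        (q * ballProfile σ x ^ p) • fderiv ℝ w x) := by
  have h1 := (hasFDerivAt_ballProfile_rpow hp σ x).mul
    (((hw.differentiable one_ne_zero x).hasFDerivAt.const_mul q).exp)
  have h2 : HasFDerivAt (fun x => ballProfile σ x ^ p * Real.exp (q * w x)) _ x := h1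
  rw [h2.fderiv]
  ext v
  simp
  ring

theorem hasCompactSupport_of_eq_zero {f : EuclideanSpace ℝ (Fin d) → ℝ} {R : ℝ}
    (h0 : ∀ x, R ≤ ‖x‖ → f x = 0) : HasCompactSupport f :=
  (isCompact_closedBall (0 : EuclideanSpace ℝ (Fin d)) R).of_isClosed_subset (isClosed_tsupport _)
    (tsupport_subset_closedBall_of_eq_zero h0)

theorem integrable_of_continuous_of_eq_zero {f : EuclideanSpace ℝ (Fin d) → ℝ} (hf : Continuous f)
    {R : ℝ} (h0 : ∀ x, R ≤ ‖x‖ → f x = 0) : Integrable f :=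
  hf.integrable_of_hasCompactSupport (hasCompactSupport_of_eq_zero h0)

theorem integrableOn_ball_exp (hw : Continuous w) (q σ : ℝ) :
    IntegrableOn (fun x => Real.exp (q * w x)) (ball 0 σ) :=
  ((Continuous.continuousOn (by fun_prop)).integrableOn_compact
    (isCompact_closedBall (0 : EuclideanSpace ℝ (Fin d)) σ)).mono_set ball_subset_closedBall

/-- The Caccioppoli inequality for powers of `exp w`. -/
theorem IsLogSol.caccioppoli (hw : IsLogSol p Λ w) (hp : 1 < p) (hΛ : 0 ≤ Λ) {δ q σ : ℝ}
    (hδ : 0 < δ) (hq : δ ≤ |q - (p - 1)|) (hσ : 0 < σ) (hσ1 : σ ≤ 1) :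
    ∫ x, ballProfile σ x ^ p * Real.exp (q * w x) * ‖gradient w x‖ ^ p ≤
      2 / δ * (Λ + 2 * p * (4 * p / δ) ^ (p - 1)) * ∫ x in ball 0 σ, Real.exp (q * w x) := by
  obtain ⟨hw1, hwint⟩ := hw
  have hp0 : 0 < p := by linarith
  set M := 2 * p * (4 * p / δ) ^ (p - 1) with hM
  have hM0 : 0 ≤ M := by positivity
  have hθ0 := ballProfile_nonneg (d := d) σ
  have hθz : ∀ x : EuclideanSpace ℝ (Fin d), σ ≤ ‖x‖ → ballProfile σ x = 0 :=
    fun x hx => ballProfile_eq_zero hσ.le hx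
  have hθz' : ∀ {s : ℝ}, s ≠ 0 → ∀ x : EuclideanSpace ℝ (Fin d), σ ≤ ‖x‖ →
      ballProfile σ x ^ s = 0 := fun hs x hx => by rw [hθz x hx, Real.zero_rpow hs]
  have hθc : ∀ {s : ℝ}, 0 ≤ s →
      Continuous fun x : EuclideanSpace ℝ (Fin d) => ballProfile σ x ^ s :=
    fun hs => (continuous_ballProfile σ).rpow_const fun _ => Or.inr hs
  have hec : Continuous fun x => Real.exp (q * w x) := by
    have := hw1.continuous
    fun_prop
  have hgc : ∀ {s : ℝ}, 0 ≤ s → Continuous fun x => ‖gradient w x‖ ^ s :=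
    fun hs => (continuous_gradient hw1).norm.rpow_const fun _ => Or.inr hs
  set ψ : EuclideanSpace ℝ (Fin d) → ℝ := fun x => ballProfile σ x ^ p * Real.exp (q * w x) with hψ
  have hψ1 : ContDiff ℝ 1 ψ := contDiff_testFunction hp hw1 σ q
  have hψz : ∀ x, σ ≤ ‖x‖ → ψ x = 0 := fun x hx => by
    simp only [hψ, hθz' hp0.ne' x hx, zero_mul]
  have hψnn : ∀ x, 0 ≤ ψ x := fun x =>
    mul_nonneg (Real.rpow_nonneg (hθ0 x) _) (Real.exp_pos _).le
  have hψi : Integrable ψ := integrable_of_continuous_of_eq_zero hψ1.continuous hψz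
  have key := hwint ψ hψ1 (fun x hx => hψz x (hσ1.trans hx)) hψnn
  -- the three integrands
  set A : EuclideanSpace ℝ (Fin d) → ℝ := fun x => ψ x * ‖gradient w x‖ ^ p with hA
  set B : EuclideanSpace ℝ (Fin d) → ℝ := fun x => Real.exp (q * w x) *
    (‖gradient w x‖ ^ (p - 2) * (-(2 * p * ballProfile σ x ^ (p - 1)) * ⟪x, gradient w x⟫)) with hB
  set D : EuclideanSpace ℝ (Fin d) → ℝ := fun x => Real.exp (q * w x) *
    (2 * p * (ballProfile σ x * ‖gradient w x‖) ^ (p - 1)) with hD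
  have hAi : Integrable A := integrable_of_continuous_of_eq_zero
    (hψ1.continuous.mul (hgc hp0.le)) (R := σ) (fun x hx => by simp only [hA, hψz x hx, zero_mul])
  have hDi : Integrable D := by
    refine integrable_of_continuous_of_eq_zero (hec.mul (continuous_const.mul
      (((continuous_ballProfile σ).mul (continuous_gradient hw1).norm).rpow_const
        fun _ => Or.inr (by linarith)))) (R := σ) (fun x hx => ?_)
    simp only [hD, hθz x hx, zero_mul, Real.zero_rpow (by linarith : p - 1 ≠ 0), mul_zero]
  have hBD : ∀ x, |B x| ≤ D x := by
    intro x
    have hg0 := norm_nonneg (gradient w x)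
    simp only [hB, hD]
    rw [abs_mul, abs_of_pos (Real.exp_pos _)]
    refine mul_le_mul_of_nonneg_left ?_ (Real.exp_pos _).le
    rcases le_or_gt σ ‖x‖ with hx | hx
    · simp only [hθz x hx, zero_mul, Real.zero_rpow (by linarith : p - 1 ≠ 0), mul_zero, neg_zero,
        abs_zero, le_refl]
    · rw [abs_mul, abs_mul, abs_neg, abs_of_nonneg (Real.rpow_nonneg hg0 _),
        abs_of_nonneg (mul_nonneg (by positivity) (Real.rpow_nonneg (hθ0 x) _)),
        Real.mul_rpow (hθ0 x) hg0, ← rpow_sub_two_mul_self hg0 hp]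
      have h1 : |⟪x, gradient w x⟫| ≤ ‖gradient w x‖ :=
        (abs_real_inner_le_norm _ _).trans
          (mul_le_of_le_one_left hg0 (hx.le.trans hσ1))
      have h2 : 0 ≤ ‖gradient w x‖ ^ (p - 2) * (2 * p * ballProfile σ x ^ (p - 1)) :=
        mul_nonneg (Real.rpow_nonneg hg0 _)
          (mul_nonneg (by positivity) (Real.rpow_nonneg (hθ0 x) _))
      nlinarith [mul_le_mul_of_nonneg_left h1 h2]
  have hBi : Integrable B := by
    refine hDi.mono' ?_ (Eventually.of_forall hBD)
    have hm := measurable_gradient w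
    refine Measurable.aestronglyMeasurable (hec.measurable.mul ((hm.norm.pow_const _).mul ?_))
    exact (((hθc (by linarith : 0 ≤ p - 1)).measurable.const_mul _).neg).mul
      (measurable_id.inner hm)
  have hI : ∀ x, ‖gradient w x‖ ^ (p - 2) * fderiv ℝ ψ x (gradient w x) -
      (p - 1) * ‖gradient w x‖ ^ p * ψ x = B x + (q - (p - 1)) * A x := by
    intro x
    have h1 : fderiv ℝ w x (gradient w x) = ‖gradient w x‖ ^ 2 := by
      rw [← inner_gradient_left, real_inner_self_eq_norm_sq]
    rw [hψ, fderiv_testFunction hp hw1]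
    simp only [hA, hB, hψ, smul_apply, add_apply, smul_eq_mul, innerSL_apply_apply, h1]
    rw [← rpow_sub_two_mul_sq (norm_nonneg (gradient w x)) hp]
    ring
  have hIeq : ∫ x, (‖gradient w x‖ ^ (p - 2) * fderiv ℝ ψ x (gradient w x) -
      (p - 1) * ‖gradient w x‖ ^ p * ψ x) = (∫ x, B x) + (q - (p - 1)) * ∫ x, A x := by
    rw [← integral_const_mul, ← integral_add hBi (hAi.const_mul _)]
    exact integral_congr_ae (Eventually.of_forall hI)
  rw [hIeq] at key
  have hA0 : 0 ≤ ∫ x, A x := integral_nonneg fun x =>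
    mul_nonneg (hψnn x) (Real.rpow_nonneg (norm_nonneg _) _)
  have hJi : Integrable ((ball 0 σ).indicator fun x => Real.exp (q * w x)) :=
    (integrable_indicator_iff measurableSet_ball).2 (integrableOn_ball_exp hw1.continuous q σ)
  have hJ : ∫ x, (ball 0 σ).indicator (fun x => Real.exp (q * w x)) x =
      ∫ x in ball 0 σ, Real.exp (q * w x) := integral_indicator measurableSet_ball
  have hψJ : ∫ x, ψ x ≤ ∫ x in ball 0 σ, Real.exp (q * w x) := by
    rw [← hJ]
    refine integral_mono hψi hJi fun x => ?_
    by_cases hx : x ∈ ball 0 σ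
    · rw [indicator_of_mem hx]
      exact mul_le_of_le_one_left (Real.exp_pos _).le
        (Real.rpow_le_one (hθ0 x) (ballProfile_le_one hσ.le hσ1 x) hp0.le)
    · rw [indicator_of_notMem hx, hψz x (by simpa using hx)]
  have hDJ : ∫ x, D x ≤ δ / 2 * (∫ x, A x) + M * ∫ x in ball 0 σ, Real.exp (q * w x) := by
    rw [← hJ, ← integral_const_mul, ← integral_const_mul,
      ← integral_add (hAi.const_mul _) (hJi.const_mul _)]
    refine integral_mono hDi ((hAi.const_mul _).add (hJi.const_mul _)) fun x => ?_
    by_cases hx : x ∈ ball 0 σ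
    · simp only [hD, hA, hψ, indicator_of_mem hx]
      have hb := two_mul_rpow_le hp hδ (mul_nonneg (hθ0 x) (norm_nonneg (gradient w x)))
      rw [Real.mul_rpow (hθ0 x) (norm_nonneg _) (z := p)] at hb
      nlinarith [mul_le_mul_of_nonneg_left hb (Real.exp_pos (q * w x)).le]
    · have hx' : σ ≤ ‖x‖ := by simpa using hx
      simp only [hD, hA, hψz x hx', indicator_of_notMem hx, hθz x hx', zero_mul,
        Real.zero_rpow (by linarith : p - 1 ≠ 0), mul_zero, add_zero, le_refl]
  have hBle : |∫ x, B x| ≤ ∫ x, D x :=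
    norm_integral_le_of_norm_le (f := B) hDi (Eventually.of_forall hBD)
  have h1 : |q - (p - 1)| * ∫ x, A x ≤ Λ * (∫ x, ψ x) + ∫ x, D x := by
    have h0 : |(q - (p - 1)) * ∫ x, A x| = |q - (p - 1)| * ∫ x, A x := by
      rw [abs_mul, abs_of_nonneg hA0]
    rw [← h0]
    have := abs_add_le ((∫ x, B x) + (q - (p - 1)) * ∫ x, A x) (-∫ x, B x)
    rw [abs_neg] at this
    calc |(q - (p - 1)) * ∫ x, A x|
        = |((∫ x, B x) + (q - (p - 1)) * ∫ x, A x) + (-∫ x, B x)| := by ring_nf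
      _ ≤ _ := by linarith
  have h2 : δ * ∫ x, A x ≤ |q - (p - 1)| * ∫ x, A x := mul_le_mul_of_nonneg_right hq hA0
  have h3 := mul_le_mul_of_nonneg_left hψJ hΛ
  have h4 : δ / 2 * ∫ x, A x ≤ (Λ + M) * ∫ x in ball 0 σ, Real.exp (q * w x) := by linarith
  have h5 : ∫ x, A x = 2 / δ * (δ / 2 * ∫ x, A x) := by field_simp
  calc ∫ x, A x = 2 / δ * (δ / 2 * ∫ x, A x) := h5
    _ ≤ 2 / δ * ((Λ + M) * ∫ x in ball 0 σ, Real.exp (q * w x)) := by gcongr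
    _ = _ := by ring

end Caccioppoli

section SobolevStep

variable {d : ℕ} {p Λ : ℝ} {w : EuclideanSpace ℝ (Fin d) → ℝ}

/-- The Gagliardo–Nirenberg–Sobolev inequality, stated with Bochner integrals. -/
theorem exists_integral_rpow_le {κ : ℝ} (hκ : Real.HolderConjugate d κ) :
    ∃ C : ℝ, 0 < C ∧ ∀ ψ : EuclideanSpace ℝ (Fin d) → ℝ, ContDiff ℝ 1 ψ → HasCompactSupport ψ →
      (∀ x, 0 ≤ ψ x) → ∫ x, ψ x ^ κ ≤ C * (∫ x, ‖fderiv ℝ ψ x‖) ^ κ := by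
  set c := lintegralPowLePowLIntegralFDerivConst
    (volume : Measure (EuclideanSpace ℝ (Fin d))) κ with hc
  refine ⟨c + 1, by positivity, fun ψ hψ hs h0 => ?_⟩
  have hκ0 : 0 < κ := hκ.symm.pos
  have hfr : Module.finrank ℝ (EuclideanSpace ℝ (Fin d)) = d := by simp
  have h := lintegral_pow_le_pow_lintegral_fderiv
    (volume : Measure (EuclideanSpace ℝ (Fin d))) hψ hs (p := κ) (by rw [hfr]; exact hκ)
  rw [← hc] at h
  have hi : Integrable (fderiv ℝ ψ) :=
    (hψ.continuous_fderiv one_ne_zero).integrable_of_hasCompactSupport (hs.fderiv ℝ)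
  have hI0 : 0 ≤ ∫ x, ‖fderiv ℝ ψ x‖ := integral_nonneg fun x => norm_nonneg _
  rw [← ofReal_integral_norm_eq_lintegral_enorm hi, ENNReal.ofReal_rpow_of_nonneg hI0 hκ0.le] at h
  have h2 : ∀ x, ‖ψ x‖ₑ ^ κ = ENNReal.ofReal (ψ x ^ κ) := fun x => by
    rw [Real.enorm_of_nonneg (h0 x), ENNReal.ofReal_rpow_of_nonneg (h0 x) hκ0.le]
  simp only [h2] at h
  have hm : AEStronglyMeasurable (fun x => ψ x ^ κ) volume :=
    (hψ.continuous.rpow_const fun _ => Or.inr hκ0.le).aestronglyMeasurable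
  rw [integral_eq_lintegral_of_nonneg_ae (Eventually.of_forall fun x => Real.rpow_nonneg (h0 x) _)
    hm]
  refine ENNReal.toReal_le_of_le_ofReal (by positivity) (h.trans ?_)
  rw [ENNReal.ofReal_mul (by positivity)]
  gcongr
  rw [← ENNReal.ofReal_coe_nnreal]
  exact ENNReal.ofReal_le_ofReal (by simp)

theorem setIntegral_exp_pos (hw : Continuous w) (q : ℝ) {σ : ℝ} (hσ : 0 < σ) :
    0 < ∫ x in ball 0 σ, Real.exp (q * w x) := by
  have hne : NeZero (volume.restrict (ball (0 : EuclideanSpace ℝ (Fin d)) σ)) :=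
    ⟨by
      rw [Ne, Measure.restrict_eq_zero]
      exact (measure_ball_pos volume _ hσ).ne'⟩
  exact integral_exp_pos (integrableOn_ball_exp hw q σ)

theorem IsLogSol.integral_norm_fderiv_testFunction_le (hw : IsLogSol p Λ w) (hp : 1 < p)
    (hΛ : 0 ≤ Λ) {δ q σ : ℝ} (hδ : 0 < δ) (hq : δ ≤ |q - (p - 1)|) (hσ : 0 < σ) (hσ1 : σ ≤ 1) :
    ∫ x, ‖fderiv ℝ (fun x => ballProfile σ x ^ p * Real.exp (q * w x)) x‖ ≤
      (2 * p + 1 + 2 / δ * (Λ + 2 * p * (4 * p / δ) ^ (p - 1))) * (1 + |q|) *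
        ∫ x in ball 0 σ, Real.exp (q * w x) := by
  have hp0 : 0 < p := by linarith
  have hcacc := hw.caccioppoli hp hΛ hδ hq hσ hσ1
  have hw1 := hw.1
  have hθ0 := ballProfile_nonneg (d := d) σ
  set ψ : EuclideanSpace ℝ (Fin d) → ℝ := fun x => ballProfile σ x ^ p * Real.exp (q * w x) with hψ
  have hψ1 : ContDiff ℝ 1 ψ := contDiff_testFunction hp hw1 σ q
  have hψz : ∀ x, σ ≤ ‖x‖ → ψ x = 0 := fun x hx => by
    simp only [hψ, ballProfile_eq_zero hσ.le hx, Real.zero_rpow hp0.ne', zero_mul]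
  have hψnn : ∀ x, 0 ≤ ψ x := fun x =>
    mul_nonneg (Real.rpow_nonneg (hθ0 x) _) (Real.exp_pos _).le
  set A : EuclideanSpace ℝ (Fin d) → ℝ := fun x => ψ x * ‖gradient w x‖ ^ p with hA
  have hAi : Integrable A := integrable_of_continuous_of_eq_zero
    (hψ1.continuous.mul ((continuous_gradient hw1).norm.rpow_const fun _ => Or.inr hp0.le))
    (R := σ) (fun x hx => by simp only [hA, hψz x hx, zero_mul])
  have hJi : Integrable ((ball 0 σ).indicator fun x => Real.exp (q * w x)) :=
    (integrable_indicator_iff measurableSet_ball).2 (integrableOn_ball_exp hw1.continuous q σ)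
  have hJ : ∫ x, (ball 0 σ).indicator (fun x => Real.exp (q * w x)) x =
      ∫ x in ball 0 σ, Real.exp (q * w x) := integral_indicator measurableSet_ball
  have hi : Integrable fun x => ‖fderiv ℝ ψ x‖ :=
    ((hψ1.continuous_fderiv one_ne_zero).integrable_of_hasCompactSupport
      ((hasCompactSupport_of_eq_zero hψz).fderiv ℝ)).norm
  have hle : ∫ x, ‖fderiv ℝ ψ x‖ ≤
      (2 * p + |q|) * (∫ x in ball 0 σ, Real.exp (q * w x)) + |q| * ∫ x, A x := by
    rw [← hJ, ← integral_const_mul, ← integral_const_mul,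
      ← integral_add (hJi.const_mul _) (hAi.const_mul _)]
    refine integral_mono hi ((hJi.const_mul _).add (hAi.const_mul _)) fun x => ?_
    simp only
    rw [hψ, fderiv_testFunction hp hw1]
    by_cases hx : x ∈ ball 0 σ
    · rw [indicator_of_mem hx]
      have hx1 : ‖x‖ ≤ 1 := by
        rw [mem_ball_zero_iff] at hx
        linarith
      have ha : ‖gradient w x‖ ≤ 1 + ‖gradient w x‖ ^ p := by
        rcases le_total ‖gradient w x‖ 1 with h | h
        · have := Real.rpow_nonneg (norm_nonneg (gradient w x)) p
          linarith
        · have := Real.self_le_rpow_of_one_le h hp.le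
          linarith
      have hθ1 : ballProfile σ x ^ (p - 1) ≤ 1 :=
        Real.rpow_le_one (hθ0 x) (ballProfile_le_one hσ.le hσ1 x) (by linarith)
      have hθ1' : ballProfile σ x ^ p ≤ 1 :=
        Real.rpow_le_one (hθ0 x) (ballProfile_le_one hσ.le hσ1 x) hp0.le
      have hθn : 0 ≤ ballProfile σ x ^ (p - 1) := Real.rpow_nonneg (hθ0 x) _
      have hθn' : 0 ≤ ballProfile σ x ^ p := Real.rpow_nonneg (hθ0 x) _
      rw [norm_smul, Real.norm_of_nonneg (Real.exp_pos _).le]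
      have h1 : ‖(-(2 * p * ballProfile σ x ^ (p - 1))) • innerSL ℝ x +
          (q * ballProfile σ x ^ p) • fderiv ℝ w x‖ ≤
          2 * p + |q| + |q| * (ballProfile σ x ^ p * ‖gradient w x‖ ^ p) := by
        refine (norm_add_le _ _).trans ?_
        rw [norm_smul, norm_smul, ← norm_gradient, innerSL_apply_norm, norm_neg, Real.norm_eq_abs,
          Real.norm_eq_abs, abs_mul q, abs_of_nonneg hθn',
          abs_of_nonneg (mul_nonneg (by positivity) hθn)]
        have h2 : 2 * p * ballProfile σ x ^ (p - 1) * ‖x‖ ≤ 2 * p * 1 * 1 := by gcongr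
        have h3 : |q| * ballProfile σ x ^ p * ‖gradient w x‖ ≤
            |q| * ballProfile σ x ^ p * (1 + ‖gradient w x‖ ^ p) := by gcongr
        have h4 : |q| * ballProfile σ x ^ p ≤ |q| * 1 := by gcongr
        linarith
      have h5 := mul_le_mul_of_nonneg_left h1 (Real.exp_pos (q * w x)).le
      simp only [hA, hψ]
      linarith
    · have hx' : σ ≤ ‖x‖ := by simpa using hx
      simp only [hA, hψz x hx', indicator_of_notMem hx, ballProfile_eq_zero hσ.le hx',
        Real.zero_rpow (by linarith : p - 1 ≠ 0), Real.zero_rpow hp0.ne', mul_zero, neg_zero,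
        zero_smul, add_zero, smul_zero, norm_zero, zero_mul, le_refl]
  have hJ0 := setIntegral_exp_pos hw1.continuous q hσ
  set J := ∫ x in ball 0 σ, Real.exp (q * w x)
  set K := 2 / δ * (Λ + 2 * p * (4 * p / δ) ^ (p - 1))
  have hK : 0 ≤ K := by positivity
  have h6 : |q| * ∫ x, A x ≤ |q| * (K * J) := mul_le_mul_of_nonneg_left hcacc (abs_nonneg _)
  have hq0 := abs_nonneg q
  nlinarith [mul_nonneg hK hJ0.le, mul_nonneg (mul_nonneg hp0.le hq0) hJ0.le]

/-- The logarithmic form of one step of Moser's iteration. -/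
theorem exists_log_integral_le (hp : 1 < p) (hΛ : 0 ≤ Λ) {κ δ : ℝ}
    (hκ : Real.HolderConjugate d κ) (hδ : 0 < δ) :
    ∃ k : ℝ, 0 ≤ k ∧ ∀ w : EuclideanSpace ℝ (Fin d) → ℝ, IsLogSol p Λ w →
      ∀ q σ τ : ℝ, δ ≤ |q - (p - 1)| → 0 < τ → τ < σ → σ ≤ 1 →
        Real.log (∫ x in ball 0 τ, Real.exp (κ * q * w x)) / κ ≤
          k + Real.log (1 + |q|) - 2 * p * Real.log (σ - τ) +
            Real.log (∫ x in ball 0 σ, Real.exp (q * w x)) := by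
  obtain ⟨C, hC, hS⟩ := exists_integral_rpow_le hκ
  have hp0 : 0 < p := by linarith
  have hκ0 : 0 < κ := hκ.symm.pos
  set K := 2 * p + 1 + 2 / δ * (Λ + 2 * p * (4 * p / δ) ^ (p - 1)) with hK
  have hK0 : 0 < K := by positivity
  refine ⟨max 0 (Real.log C / κ + Real.log K), le_max_left _ _,
    fun w hw q σ τ hq hτ hτσ hσ1 => ?_⟩
  have hσ : 0 < σ := hτ.trans hτσ
  have hD := hw.integral_norm_fderiv_testFunction_le hp hΛ hδ hq hσ hσ1
  have hw1 := hw.1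
  have hJ0 := setIntegral_exp_pos hw1.continuous q hσ
  have hF0 := setIntegral_exp_pos hw1.continuous (κ * q) hτ
  have hθ0 := ballProfile_nonneg (d := d) σ
  have hψ1 := contDiff_testFunction hp hw1 σ q
  have hψz : ∀ x, σ ≤ ‖x‖ → ballProfile σ x ^ p * Real.exp (q * w x) = 0 := fun x hx => by
    simp only [ballProfile_eq_zero hσ.le hx, Real.zero_rpow hp0.ne', zero_mul]
  have hψnn : ∀ x, 0 ≤ ballProfile σ x ^ p * Real.exp (q * w x) := fun x =>
    mul_nonneg (Real.rpow_nonneg (hθ0 x) _) (Real.exp_pos _).le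
  have h1 := hS _ hψ1 (hasCompactSupport_of_eq_zero hψz) hψnn
  rw [← hK] at hD
  set J := ∫ x in ball 0 σ, Real.exp (q * w x)
  set F := ∫ x in ball 0 τ, Real.exp (κ * q * w x) with hF
  have hστ : 0 < σ - τ := sub_pos.2 hτσ
  have hcψ : Continuous fun x => (ballProfile σ x ^ p * Real.exp (q * w x)) ^ κ :=
    hψ1.continuous.rpow_const fun _ => Or.inr hκ0.le
  have h2 : (σ - τ) ^ (2 * p * κ) * F ≤
      ∫ x, (ballProfile σ x ^ p * Real.exp (q * w x)) ^ κ := by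
    rw [hF, ← integral_const_mul]
    refine (setIntegral_mono_on ((integrableOn_ball_exp hw1.continuous _ _).const_mul _)
      ((hcψ.continuousOn.integrableOn_compact (isCompact_closedBall 0 τ)).mono_set
        ball_subset_closedBall) measurableSet_ball fun x hx => ?_).trans
      (setIntegral_le_integral ?_ (Eventually.of_forall fun x => Real.rpow_nonneg (hψnn x) _))
    · have h3 := le_ballProfile hτσ.le hτ.le (mem_ball_zero_iff.1 hx).le
      rw [Real.mul_rpow (Real.rpow_nonneg (hθ0 x) _) (Real.exp_pos _).le, ← Real.exp_mul,
        ← Real.rpow_mul (hθ0 x)]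
      have h4 : (σ - τ) ^ (2 * p * κ) = ((σ - τ) ^ 2) ^ (p * κ) := by
        rw [← Real.rpow_natCast, ← Real.rpow_mul hστ.le]
        norm_num
        ring_nf
      rw [h4, show q * w x * κ = κ * q * w x by ring]
      gcongr
    · exact integrable_of_continuous_of_eq_zero hcψ (R := σ) fun x hx => by
        rw [hψz x hx, Real.zero_rpow hκ0.ne']
  have hq1 : 0 < 1 + |q| := by positivity
  have h5 : (σ - τ) ^ (2 * p * κ) * F ≤ C * (K * (1 + |q|) * J) ^ κ :=
    h2.trans (h1.trans (by gcongr))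
  have h6 := Real.log_le_log (by positivity) h5
  rw [Real.log_mul (by positivity) hF0.ne', Real.log_rpow hστ, Real.log_mul hC.ne' (by positivity),
    Real.log_rpow (by positivity), Real.log_mul (by positivity) hJ0.ne',
    Real.log_mul hK0.ne' hq1.ne'] at h6
  have h7 : Real.log C / κ + Real.log K ≤ max 0 (Real.log C / κ + Real.log K) := le_max_right _ _
  have h8 : Real.log F / κ ≤ Real.log C / κ + (Real.log K + Real.log (1 + |q|) + Real.log J) -
      2 * p * Real.log (σ - τ) := by
    rw [div_le_iff₀ hκ0]
    have : Real.log C / κ * κ = Real.log C := by field_simp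
    linear_combination h6 - this
  linarith

end SobolevStep

section MoserIteration

theorem le_add_of_geometric_increments {κ A B : ℝ} (hκ : 1 < κ) (hA : 0 ≤ A) (hB : 0 ≤ B)
    {c : ℕ → ℝ} (hc : ∀ j, c (j + 1) ≤ c j + (κ⁻¹) ^ j * (A + B * j)) (j : ℕ) :
    c j ≤ c 0 + (A * ∑' i : ℕ, (κ⁻¹) ^ i + B * ∑' i : ℕ, (i : ℝ) * (κ⁻¹) ^ i) := by
  have hκ0 : 0 < κ := by linarith
  have hr : ‖κ⁻¹‖ < 1 := by
    rw [Real.norm_of_nonneg (by positivity)]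
    exact inv_lt_one_of_one_lt₀ hκ
  have hs0 : Summable fun i : ℕ => (κ⁻¹) ^ i := summable_geometric_of_norm_lt_one hr
  have hs1 : Summable fun i : ℕ => (i : ℝ) * (κ⁻¹) ^ i := by
    simpa using summable_pow_mul_geometric_of_norm_lt_one 1 hr
  have h : c j ≤ c 0 + (A * ∑ i ∈ Finset.range j, (κ⁻¹) ^ i +
      B * ∑ i ∈ Finset.range j, (i : ℝ) * (κ⁻¹) ^ i) := by
    induction j with
    | zero => simp
    | succ j ih =>
      rw [Finset.sum_range_succ, Finset.sum_range_succ]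
      linarith [hc j]
  refine h.trans ?_
  have h0 := hs0.sum_le_tsum (Finset.range j) fun i _ => by positivity
  have h1 := hs1.sum_le_tsum (Finset.range j) fun i _ => by positivity
  gcongr

variable {d : ℕ} {p Λ : ℝ}

/-- A continuous function is bounded by the limit of its exponential means over balls. -/
theorem le_of_forall_log_integral_le {f : EuclideanSpace ℝ (Fin d) → ℝ} (hf : Continuous f)
    {κ M : ℝ} (hκ : 1 < κ) {x : EuclideanSpace ℝ (Fin d)} {s : ℝ} (hx : ‖x‖ < s) {σ : ℕ → ℝ}
    (hσ : ∀ j, s ≤ σ j)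
    (h : ∀ j, (κ⁻¹) ^ j * Real.log (∫ y in ball 0 (σ j), Real.exp (κ ^ j * f y)) ≤ M) :
    f x ≤ M := by
  have hκ0 : 0 < κ := by linarith
  refine le_of_forall_pos_le_add fun ε hε => ?_
  have h1 : ∀ᶠ y in 𝓝 x, f x - ε < f y := hf.continuousAt.eventually (lt_mem_nhds (by linarith))
  obtain ⟨ρ, hρ, hball⟩ := Metric.eventually_nhds_iff_ball.1
    (h1.and (isOpen_ball.mem_nhds (mem_ball_zero_iff.2 hx)))
  set b := volume.real (ball x ρ) with hb
  have hb0 : 0 < b := ENNReal.toReal_pos (measure_ball_pos volume _ hρ).ne' measure_ball_lt_top.ne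
  have hj : ∀ j, (κ⁻¹) ^ j * Real.log b + (f x - ε) ≤ M := by
    intro j
    refine le_trans ?_ (h j)
    have hpow : 0 < κ ^ j := by positivity
    have h2 : b * Real.exp (κ ^ j * (f x - ε)) ≤
        ∫ y in ball 0 (σ j), Real.exp (κ ^ j * f y) := by
      calc b * Real.exp (κ ^ j * (f x - ε))
          = ∫ y in ball x ρ, Real.exp (κ ^ j * (f x - ε)) := by
            rw [setIntegral_const, smul_eq_mul]
        _ ≤ ∫ y in ball x ρ, Real.exp (κ ^ j * f y) := by
            refine setIntegral_mono_on (integrableOn_const measure_ball_lt_top.ne)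
              ((integrableOn_ball_exp hf _ s).mono_set fun y hy => (hball y hy).2)
              measurableSet_ball fun y hy => ?_
            have := (hball y hy).1.le
            gcongr
        _ ≤ _ := setIntegral_mono_set (integrableOn_ball_exp hf _ _)
            (Eventually.of_forall fun y => (Real.exp_pos _).le)
            (LE.le.eventuallyLE fun y hy => ball_subset_ball (hσ j) (hball y hy).2)
    have h3 := Real.log_le_log (by positivity) h2
    rw [Real.log_mul hb0.ne' (Real.exp_pos _).ne', Real.log_exp] at h3
    have h4 : (κ⁻¹) ^ j * κ ^ j = 1 := by
      rw [← mul_pow, inv_mul_cancel₀ hκ0.ne', one_pow]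
    calc (κ⁻¹) ^ j * Real.log b + (f x - ε)
        = (κ⁻¹) ^ j * (Real.log b + κ ^ j * (f x - ε)) := by linear_combination (-(f x - ε)) * h4
      _ ≤ _ := by gcongr
  have hlim : Tendsto (fun j : ℕ => (κ⁻¹) ^ j * Real.log b + (f x - ε)) atTop
      (𝓝 (0 * Real.log b + (f x - ε))) :=
    ((tendsto_pow_atTop_nhds_zero_of_lt_one (by positivity)
      (inv_lt_one_of_one_lt₀ hκ)).mul_const _).add_const _
  have := le_of_tendsto' hlim hj
  linarith

/-- The local `L^q`-to-`L^∞` bound obtained by Moser iteration. -/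
theorem exists_moser_bound (hp : 1 < p) (hΛ : 0 ≤ Λ) {κ δ : ℝ}
    (hκ : Real.HolderConjugate d κ) (hδ : 0 < δ) (Q : ℝ) :
    ∃ K a : ℝ, 0 < a ∧ ∀ w : EuclideanSpace ℝ (Fin d) → ℝ, IsLogSol p Λ w →
      ∀ q : ℝ, |q| ≤ Q → (∀ j : ℕ, δ ≤ |κ ^ j * q - (p - 1)|) →
        ∀ (x : EuclideanSpace ℝ (Fin d)) (σ : ℝ), ‖x‖ < σ → σ ≤ 1 →
          q * w x ≤ K - a * Real.log (σ - ‖x‖) +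
            Real.log (∫ y in ball 0 σ, Real.exp (q * w y)) := by
  obtain ⟨k, hk, H⟩ := exists_log_integral_le hp hΛ hκ hδ
  have hκ1 : 1 < κ := hκ.symm.lt
  have hκ0 : 0 < κ := by linarith
  have hp0 : 0 < p := by linarith
  set S := ∑' i : ℕ, (κ⁻¹) ^ i with hS
  set T := ∑' i : ℕ, (i : ℝ) * (κ⁻¹) ^ i with hT
  have hκi : κ⁻¹ < 1 := inv_lt_one_of_one_lt₀ hκ1
  have hS0 : 0 < S := by
    rw [hS, tsum_geometric_of_lt_one (by positivity) hκi]
    exact inv_pos.2 (sub_pos.2 hκi)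
  have hlogκ : 0 ≤ Real.log κ := Real.log_nonneg hκ1.le
  have hlog2 : 0 ≤ Real.log 2 := Real.log_nonneg one_le_two
  refine ⟨(k + Real.log (1 + |Q|) + 4 * p * Real.log 2) * S +
    (Real.log κ + 2 * p * Real.log 2) * T, 2 * p * S, by positivity, ?_⟩
  intro w hw q hqQ hq x σ hx hσ1
  have hQ : |q| ≤ |Q| := hqQ.trans (le_abs_self Q)
  set D := σ - ‖x‖ with hD
  have hx0 := norm_nonneg x
  have hD0 : 0 < D := sub_pos.2 hx
  have hD1 : D ≤ 1 := by linarith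
  have hlogD : Real.log D ≤ 0 := Real.log_nonpos hD0.le hD1
  have hlogQ : 0 ≤ Real.log (1 + |Q|) := Real.log_nonneg (by linarith [abs_nonneg Q])
  obtain ⟨s, hs⟩ : ∃ s : ℕ → ℝ, s = fun j => σ - D / 2 + D / 2 * (1 / 2) ^ j := ⟨_, rfl⟩
  have hsl : ∀ j, σ - D / 2 < s j := fun j => by
    have : 0 < D / 2 * (1 / 2 : ℝ) ^ j := by positivity
    simp only [hs]; linarith
  have hsu : ∀ j, s j ≤ σ := fun j => by
    have : (1 / 2 : ℝ) ^ j ≤ 1 := pow_le_one₀ (by norm_num) (by norm_num)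
    simp only [hs]; nlinarith
  have hstep : ∀ j, s j - s (j + 1) = D * (1 / 2) ^ (j + 2) := fun j => by
    simp only [hs]; ring
  obtain ⟨c, hc⟩ : ∃ c : ℕ → ℝ, c = fun j =>
    (κ⁻¹) ^ j * Real.log (∫ y in ball 0 (s j), Real.exp (κ ^ j * (q * w y))) := ⟨_, rfl⟩
  set A := k + Real.log (1 + |Q|) + 4 * p * Real.log 2 - 2 * p * Real.log D with hA
  set B := Real.log κ + 2 * p * Real.log 2 with hB
  have hA0 : 0 ≤ A := by
    have : 0 ≤ 4 * p * Real.log 2 := by positivity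
    nlinarith
  have hB0 : 0 ≤ B := by positivity
  have hinc : ∀ j, c (j + 1) ≤ c j + (κ⁻¹) ^ j * (A + B * j) := by
    intro j
    have h1 := H w hw (κ ^ j * q) (s j) (s (j + 1)) (hq j) (by linarith [hsl (j + 1)])
      (by
        have : 0 < s j - s (j + 1) := by rw [hstep]; positivity
        linarith) ((hsu j).trans hσ1)
    rw [hstep, Real.log_mul hD0.ne' (by positivity), Real.log_pow, one_div, Real.log_inv] at h1
    have h2 : Real.log (1 + |κ ^ j * q|) ≤ Real.log (1 + |Q|) + j * Real.log κ := by
      rw [← Real.log_pow, ← Real.log_mul (by positivity) (by positivity)]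
      refine Real.log_le_log (by positivity) ?_
      rw [abs_mul, abs_of_pos (by positivity : 0 < κ ^ j)]
      have h3 : (1 : ℝ) ≤ κ ^ j := one_le_pow₀ hκ1.le
      nlinarith
    have h4 : c (j + 1) = (κ⁻¹) ^ j *
        (Real.log (∫ y in ball 0 (s (j + 1)), Real.exp (κ * (κ ^ j * q) * w y)) / κ) := by
      simp only [hc]
      rw [pow_succ, div_eq_mul_inv]
      have : ∀ y, κ ^ (j + 1) * (q * w y) = κ * (κ ^ j * q) * w y := fun y => by ring
      simp only [this]
      ring
    have h5 : c j = (κ⁻¹) ^ j *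
        Real.log (∫ y in ball 0 (s j), Real.exp (κ ^ j * q * w y)) := by
      simp only [hc, mul_assoc]
    rw [h4, h5, ← mul_add]
    refine mul_le_mul_of_nonneg_left (h1.trans ?_) (by positivity)
    push_cast
    simp only [hA, hB]
    linarith
  have hbd := le_add_of_geometric_increments hκ1 hA0 hB0 hinc
  have hwc := hw.1.continuous
  have hfin := le_of_forall_log_integral_le (f := fun y => q * w y) (by fun_prop) hκ1
    (M := c 0 + (A * S + B * T)) (x := x) (s := σ - D / 2) (by linarith) (fun j => (hsl j).le)
    (fun j => by simpa only [hc] using hbd j)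
  have hc0 : c 0 = Real.log (∫ y in ball 0 σ, Real.exp (q * w y)) := by
    simp [hc, hs]
  rw [hc0] at hfin
  simp only [hA] at hfin
  linarith

/-- Geometric grids of exponents of either sign that stay away from `p - 1` under scaling. -/
theorem le_abs_pow_mul_sub {t P : ℝ} (ht : 1 < t) (hP : 0 < P) (n j : ℕ) :
    P * (1 - t⁻¹) ≤ |(t ^ 2) ^ j * (P * (t⁻¹) ^ (2 * n + 1)) - P| ∧
      P * (1 - t⁻¹) ≤ |(t ^ 2) ^ j * (-(P * (t⁻¹) ^ (2 * n + 1))) - P| := by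
  have ht0 : 0 < t := by linarith
  have hti : t⁻¹ < 1 := inv_lt_one_of_one_lt₀ ht
  have hti0 : 0 < t⁻¹ := by positivity
  constructor
  · rcases le_or_gt j n with h | h
    · have h1 : (t ^ 2) ^ j * (t⁻¹) ^ (2 * n + 1) ≤ t⁻¹ := by
        obtain ⟨m, rfl⟩ := Nat.exists_eq_add_of_le h
        have : (t ^ 2) ^ j * (t⁻¹) ^ (2 * (j + m) + 1) = (t⁻¹) ^ (2 * m) * t⁻¹ := by
          rw [← pow_mul, show 2 * (j + m) + 1 = 2 * j + (2 * m + 1) by ring, pow_add, ← mul_assoc,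
            ← mul_pow, mul_inv_cancel₀ ht0.ne', one_pow, one_mul, pow_succ]
        rw [this]
        exact mul_le_of_le_one_left hti0.le (pow_le_one₀ hti0.le hti.le)
      rw [abs_sub_comm]
      refine le_trans ?_ (le_abs_self _)
      nlinarith
    · have h1 : t ≤ (t ^ 2) ^ j * (t⁻¹) ^ (2 * n + 1) := by
        obtain ⟨m, rfl⟩ := Nat.exists_eq_add_of_lt h
        have : (t ^ 2) ^ (n + m + 1) * (t⁻¹) ^ (2 * n + 1) = t ^ (2 * m) * t := by
          rw [← pow_mul, show 2 * (n + m + 1) = (2 * m + 1) + (2 * n + 1) by ring, pow_add,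
            mul_assoc, ← mul_pow, mul_inv_cancel₀ ht0.ne', one_pow, mul_one, pow_succ]
        rw [this]
        exact le_mul_of_one_le_left ht0.le (one_le_pow₀ ht.le)
      have h2 : 1 - t⁻¹ ≤ t - 1 := by
        have : t * t⁻¹ = 1 := mul_inv_cancel₀ ht0.ne'
        nlinarith
      refine le_trans ?_ (le_abs_self _)
      nlinarith
  · rw [abs_sub_comm]
    refine le_trans ?_ (le_abs_self _)
    have : 0 ≤ (t ^ 2) ^ j * (P * (t⁻¹) ^ (2 * n + 1)) := by positivity
    nlinarith

/-- The Moser bound for `f = ± w` along a geometric grid of exponents tending to `0`. -/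
theorem exists_moser_bound_grid (hd : 2 ≤ d) (hp : 1 < p) (hΛ : 0 ≤ Λ) :
    ∃ K a s₀ ρ : ℝ, 0 < a ∧ 0 < s₀ ∧ 0 < ρ ∧ ρ < 1 ∧
      ∀ w : EuclideanSpace ℝ (Fin d) → ℝ, IsLogSol p Λ w → ∀ e : ℝ, (e = 1 ∨ e = -1) →
        ∀ (n : ℕ) (x : EuclideanSpace ℝ (Fin d)) (σ : ℝ), ‖x‖ < σ → σ ≤ 1 →
          s₀ * ρ ^ n * (e * w x) ≤ K - a * Real.log (σ - ‖x‖) +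
            Real.log (∫ y in ball 0 σ, Real.exp (s₀ * ρ ^ n * (e * w y))) := by
  have hd1 : (1 : ℝ) < d := by exact_mod_cast hd
  set κ := Real.conjExponent d with hκd
  have hκ : Real.HolderConjugate d κ := Real.HolderConjugate.conjExponent hd1
  have hκ1 : 1 < κ := hκ.symm.lt
  set t := Real.sqrt κ with ht
  have ht2 : t ^ 2 = κ := Real.sq_sqrt (by linarith)
  have ht1 : 1 < t := Real.lt_sqrt_of_sq_lt (by linarith)
  have ht0 : 0 < t := by linarith
  have hti : t⁻¹ < 1 := inv_lt_one_of_one_lt₀ ht1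
  have hti0 : 0 < t⁻¹ := by positivity
  have hP : 0 < p - 1 := by linarith
  obtain ⟨K, a, ha, H⟩ := exists_moser_bound hp hΛ hκ
    (δ := (p - 1) * (1 - t⁻¹)) (mul_pos hP (by linarith)) (p - 1)
  refine ⟨K, a, (p - 1) * t⁻¹, (t⁻¹) ^ 2, ha, by positivity, by positivity,
    pow_lt_one₀ hti0.le hti two_ne_zero, fun w hw e he n x σ hx hσ => ?_⟩
  have hs : (p - 1) * t⁻¹ * ((t⁻¹) ^ 2) ^ n = (p - 1) * (t⁻¹) ^ (2 * n + 1) := by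
    rw [← pow_mul, pow_succ]; ring
  have hq : |(p - 1) * (t⁻¹) ^ (2 * n + 1)| ≤ p - 1 := by
    rw [abs_of_nonneg (by positivity)]
    exact mul_le_of_le_one_right hP.le (pow_le_one₀ hti0.le hti.le)
  rw [hs]
  rcases he with rfl | rfl
  · simp only [one_mul]
    exact H w hw _ hq (fun j => ht2 ▸ (le_abs_pow_mul_sub ht1 hP n j).1) x σ hx hσ
  · have := H w hw (-((p - 1) * (t⁻¹) ^ (2 * n + 1))) (by rwa [abs_neg])
      (fun j => ht2 ▸ (le_abs_pow_mul_sub ht1 hP n j).2) x σ hx hσ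
    simpa only [neg_mul, one_mul, mul_neg] using this

end MoserIteration

section Poincare

open scoped ENNReal

variable {d : ℕ} {p Λ : ℝ} {w : EuclideanSpace ℝ (Fin d) → ℝ}

theorem lintegral_ball_comp_contraction_le {f : EuclideanSpace ℝ (Fin d) → ℝ≥0∞}
    (hf : Measurable f) {R t : ℝ} (ht : 1 / 2 ≤ t) (ht1 : t ≤ 1) {y : EuclideanSpace ℝ (Fin d)}
    (hy : y ∈ ball 0 R) :
    ∫⁻ x in ball 0 R, f (t • x + (1 - t) • y) ≤ 2 ^ d * ∫⁻ x in ball 0 R, f x := by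
  have ht0 : 0 < t := by linarith
  set h := (ball (0 : EuclideanSpace ℝ (Fin d)) R).indicator f with hh
  have hm : Measurable h := hf.indicator measurableSet_ball
  have h1 : ∫⁻ x in ball 0 R, f (t • x + (1 - t) • y) ≤ ∫⁻ x, h (t • x + (1 - t) • y) := by
    rw [← lintegral_indicator measurableSet_ball]
    refine lintegral_mono fun x => ?_
    by_cases hx : x ∈ ball 0 R
    · have hz : t • x + (1 - t) • y ∈ ball 0 R :=
        (convex_ball 0 R) hx hy ht0.le (by linarith) (by ring)
      simp only [hh]
      rw [indicator_of_mem hx, indicator_of_mem hz]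
    · rw [indicator_of_notMem hx]
      exact zero_le
  refine h1.trans ?_
  have hmap := lintegral_map (μ := volume) (f := fun z => h (z + (1 - t) • y))
    (hm.comp (measurable_add_const _))
    (measurable_const_smul t : Measurable fun x : EuclideanSpace ℝ (Fin d) => t • x)
  rw [← hmap, Measure.map_addHaar_smul volume ht0.ne', lintegral_smul_measure,
    lintegral_add_right_eq_self h, hh, lintegral_indicator measurableSet_ball, smul_eq_mul]
  gcongr
  rw [finrank_euclideanSpace_fin, abs_of_pos (by positivity), ← inv_pow]
  have h2 : t⁻¹ ≤ 2 := by
    rw [inv_le_comm₀ ht0 two_pos]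
    linarith
  calc ENNReal.ofReal (t⁻¹ ^ d) ≤ ENNReal.ofReal (2 ^ d) := by gcongr
    _ = 2 ^ d := by simp [ENNReal.ofReal_pow]

theorem lintegral_ball_sub_midpoint_le (hw : ContDiff ℝ 1 w) {R : ℝ} (hR : 0 < R)
    {y : EuclideanSpace ℝ (Fin d)} (hy : y ∈ ball 0 R) :
    ∫⁻ x in ball 0 R, ‖w x - w ((1 / 2 : ℝ) • x + (1 / 2 : ℝ) • y)‖ₑ ≤
      ENNReal.ofReal (2 * R) * (2 ^ d * ∫⁻ x in ball 0 R, ‖fderiv ℝ w x‖ₑ) := by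
  have hDc := hw.continuous_fderiv one_ne_zero
  have hDm : Measurable fun x => ‖fderiv ℝ w x‖ₑ := hDc.enorm.measurable
  have hpt : ∀ x ∈ ball (0 : EuclideanSpace ℝ (Fin d)) R,
      ‖w x - w ((1 / 2 : ℝ) • x + (1 / 2 : ℝ) • y)‖ₑ ≤ ENNReal.ofReal (2 * R) *
        ∫⁻ t in Ioc (1 / 2 : ℝ) 1, ‖fderiv ℝ w (t • x + (1 - t) • y)‖ₑ := by
    intro x hx
    have hγ : ∀ t : ℝ, HasDerivAt (fun t : ℝ => w (t • x + (1 - t) • y))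
        (fderiv ℝ w (t • x + (1 - t) • y) (x - y)) t := by
      intro t
      have h1 : HasDerivAt (fun t : ℝ => t • x + (1 - t) • y) (x - y) t := by
        have := ((hasDerivAt_id t).smul_const x).add
          (((hasDerivAt_id t).const_sub 1).smul_const y)
        refine (HasDerivAt.congr_deriv this ?_ : HasDerivAt (fun t : ℝ => t • x + (1 - t) • y) _ t)
        rw [one_smul, neg_one_smul, sub_eq_add_neg]
      exact ((hw.differentiable one_ne_zero _).hasFDerivAt).comp_hasDerivAt t h1
    have hcont : Continuous fun t : ℝ => fderiv ℝ w (t • x + (1 - t) • y) (x - y) := by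
      have : Continuous fun t : ℝ => t • x + (1 - t) • y := by fun_prop
      exact (hDc.comp this).clm_apply continuous_const
    have hFTC := intervalIntegral.integral_eq_sub_of_hasDerivAt (a := 1 / 2) (b := 1)
      (fun t _ => hγ t) (hcont.intervalIntegrable _ _)
    have he : w x - w ((1 / 2 : ℝ) • x + (1 / 2 : ℝ) • y) =
        ∫ t in Ioc (1 / 2 : ℝ) 1, fderiv ℝ w (t • x + (1 - t) • y) (x - y) := by
      rw [← intervalIntegral.integral_of_le (by norm_num), hFTC]
      norm_num
    rw [he]
    refine (enorm_integral_le_lintegral_enorm _).trans ?_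
    rw [← lintegral_const_mul' _ _ ENNReal.ofReal_ne_top]
    refine lintegral_mono fun t => ?_
    have hxy : ‖x - y‖ ≤ 2 * R := by
      rw [mem_ball_zero_iff] at hx hy
      linarith [norm_sub_le x y]
    rw [← ofReal_norm, ← ofReal_norm, ← ENNReal.ofReal_mul (by positivity)]
    refine ENNReal.ofReal_le_ofReal (((fderiv ℝ w _).le_opNorm _).trans ?_)
    rw [mul_comm]
    gcongr
  calc ∫⁻ x in ball 0 R, ‖w x - w ((1 / 2 : ℝ) • x + (1 / 2 : ℝ) • y)‖ₑ
      ≤ ∫⁻ x in ball 0 R, ENNReal.ofReal (2 * R) *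
        ∫⁻ t in Ioc (1 / 2 : ℝ) 1, ‖fderiv ℝ w (t • x + (1 - t) • y)‖ₑ :=
        setLIntegral_mono' measurableSet_ball hpt
    _ = ENNReal.ofReal (2 * R) * ∫⁻ t in Ioc (1 / 2 : ℝ) 1, ∫⁻ x in ball 0 R,
        ‖fderiv ℝ w (t • x + (1 - t) • y)‖ₑ := by
        rw [lintegral_const_mul' _ _ ENNReal.ofReal_ne_top, lintegral_lintegral_swap]
        refine Continuous.aemeasurable ?_
        have : Continuous fun z : EuclideanSpace ℝ (Fin d) × ℝ => z.2 • z.1 + (1 - z.2) • y := by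
          fun_prop
        exact (hDc.comp this).enorm
    _ ≤ ENNReal.ofReal (2 * R) * ∫⁻ t in Ioc (1 / 2 : ℝ) 1,
          (2 ^ d * ∫⁻ x in ball 0 R, ‖fderiv ℝ w x‖ₑ) := by
        gcongr ENNReal.ofReal (2 * R) * ?_
        exact setLIntegral_mono' measurableSet_Ioc fun t ht =>
          lintegral_ball_comp_contraction_le hDm ht.1.le ht.2 hy
    _ ≤ _ := by
        gcongr ENNReal.ofReal (2 * R) * ?_
        rw [setLIntegral_const, Real.volume_Ioc]
        refine mul_le_of_le_one_right' ?_
        rw [← ENNReal.ofReal_one]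
        exact ENNReal.ofReal_le_ofReal (by norm_num)

/-- A Poincaré inequality on balls, with a value of the function in place of its mean. -/
theorem exists_integral_abs_sub_le (hw : ContDiff ℝ 1 w) {R : ℝ} (hR : 0 < R) :
    ∃ m : ℝ, ∫ x in ball 0 R, |w x - m| ≤
      2 * (2 * R * (2 ^ d * ∫ x in ball 0 R, ‖fderiv ℝ w x‖)) := by
  set μ := volume.restrict (ball (0 : EuclideanSpace ℝ (Fin d)) R) with hμ
  have hμ0 : μ ≠ 0 := by
    rw [hμ, Ne, Measure.restrict_eq_zero]
    exact (measure_ball_pos volume _ hR).ne'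
  have hwc := hw.continuous
  set c := ENNReal.ofReal (2 * R) * (2 ^ d * ∫⁻ x, ‖fderiv ℝ w x‖ₑ ∂μ) with hc
  have hmid : Measurable fun z : EuclideanSpace ℝ (Fin d) × EuclideanSpace ℝ (Fin d) =>
      ‖w z.2 - w ((1 / 2 : ℝ) • z.2 + (1 / 2 : ℝ) • z.1)‖ₑ :=
    Continuous.measurable (by fun_prop)
  have h1 : ∫⁻ y, ∫⁻ x, ‖w x - w y‖ₑ ∂μ ∂μ ≤ 2 * c * μ univ := by
    calc ∫⁻ y, ∫⁻ x, ‖w x - w y‖ₑ ∂μ ∂μ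
        ≤ ∫⁻ y, ∫⁻ x, (‖w x - w ((1 / 2 : ℝ) • x + (1 / 2 : ℝ) • y)‖ₑ +
            ‖w y - w ((1 / 2 : ℝ) • y + (1 / 2 : ℝ) • x)‖ₑ) ∂μ ∂μ := by
          refine lintegral_mono fun y => lintegral_mono fun x => ?_
          have e : w x - w y = (w x - w ((1 / 2 : ℝ) • x + (1 / 2 : ℝ) • y)) -
              (w y - w ((1 / 2 : ℝ) • y + (1 / 2 : ℝ) • x)) := by
            rw [add_comm ((1 / 2 : ℝ) • y)]; ring
          simp only
          rw [e]
          exact enorm_sub_le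
      _ = (∫⁻ y, ∫⁻ x, ‖w x - w ((1 / 2 : ℝ) • x + (1 / 2 : ℝ) • y)‖ₑ ∂μ ∂μ) +
            ∫⁻ y, ∫⁻ x, ‖w y - w ((1 / 2 : ℝ) • y + (1 / 2 : ℝ) • x)‖ₑ ∂μ ∂μ := by
          rw [← lintegral_add_left hmid.lintegral_prod_right']
          refine lintegral_congr fun y => lintegral_add_left ?_ _
          exact hmid.comp measurable_prodMk_left
      _ = 2 * ∫⁻ y, ∫⁻ x, ‖w x - w ((1 / 2 : ℝ) • x + (1 / 2 : ℝ) • y)‖ₑ ∂μ ∂μ := by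
          rw [two_mul]
          congr 1
          rw [lintegral_lintegral_swap]
          exact (hmid.comp measurable_swap).aemeasurable
      _ ≤ 2 * ∫⁻ _, c ∂μ := by
          gcongr 2 * ?_
          exact setLIntegral_mono' measurableSet_ball fun y hy =>
            lintegral_ball_sub_midpoint_le hw hR hy
      _ = _ := by rw [lintegral_const, ← mul_assoc]
  have hm2 : Measurable fun y => ∫⁻ x, ‖w x - w y‖ₑ ∂μ := by
    have : Measurable fun z : EuclideanSpace ℝ (Fin d) × EuclideanSpace ℝ (Fin d) =>
      ‖w z.2 - w z.1‖ₑ := Continuous.measurable (by fun_prop)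
    exact this.lintegral_prod_right'
  have hμt : μ univ ≠ ∞ := by
    rw [hμ, Measure.restrict_apply_univ]
    exact measure_ball_lt_top.ne
  have hfin : IsFiniteMeasure μ := ⟨hμt.lt_top⟩
  obtain ⟨y, hy⟩ := exists_le_laverage hμ0 hm2.aemeasurable
  refine ⟨w y, ?_⟩
  have h2 : ∫⁻ x, ‖w x - w y‖ₑ ∂μ ≤ 2 * c := by
    refine hy.trans ?_
    rw [laverage_eq]
    exact ENNReal.div_le_of_le_mul h1
  have hi1 : Integrable (fun x => w x - w y) μ :=
    ((Continuous.continuousOn (by fun_prop)).integrableOn_compact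
      (isCompact_closedBall (0 : EuclideanSpace ℝ (Fin d)) R)).mono_set ball_subset_closedBall
  have hi2 : Integrable (fun x => fderiv ℝ w x) μ :=
    (((hw.continuous_fderiv one_ne_zero).continuousOn).integrableOn_compact
      (isCompact_closedBall (0 : EuclideanSpace ℝ (Fin d)) R)).mono_set ball_subset_closedBall
  rw [hc, ← ofReal_integral_norm_eq_lintegral_enorm hi1,
    ← ofReal_integral_norm_eq_lintegral_enorm hi2] at h2
  have hI0 : 0 ≤ ∫ x, ‖fderiv ℝ w x‖ ∂μ := integral_nonneg fun x => norm_nonneg _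
  have h3 : (2 : ℝ≥0∞) * (ENNReal.ofReal (2 * R) * (2 ^ d * ENNReal.ofReal
      (∫ x, ‖fderiv ℝ w x‖ ∂μ))) =
      ENNReal.ofReal (2 * (2 * R * (2 ^ d * ∫ x, ‖fderiv ℝ w x‖ ∂μ))) := by
    simp [ENNReal.ofReal_mul, hR.le, mul_assoc]
  rw [h3, ENNReal.ofReal_le_ofReal_iff (by positivity)] at h2
  exact h2

theorem IsLogSol.integral_norm_fderiv_le (hw : IsLogSol p Λ w) (hp : 1 < p) (hΛ : 0 ≤ Λ) :
    ∫ x in ball 0 (3 / 4), ‖fderiv ℝ w x‖ ≤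
      (1 + (16 / 7) ^ p * (2 / (p - 1) * (Λ + 2 * p * (4 * p / (p - 1)) ^ (p - 1)))) *
        volume.real (ball (0 : EuclideanSpace ℝ (Fin d)) 1) := by
  have hp0 : 0 < p := by linarith
  have hcacc := hw.caccioppoli (q := 0) (σ := 1) hp hΛ (sub_pos.2 hp)
    (by rw [zero_sub, abs_neg]; exact le_abs_self _) one_pos le_rfl
  simp only [zero_mul, Real.exp_zero, mul_one, setIntegral_const, smul_eq_mul] at hcacc
  have hw1 := hw.1
  have hgc : Continuous fun x => ‖gradient w x‖ ^ p :=
    (continuous_gradient hw1).norm.rpow_const fun _ => Or.inr hp0.le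
  have hθc : Continuous fun x : EuclideanSpace ℝ (Fin d) => ballProfile 1 x ^ p :=
    (continuous_ballProfile 1).rpow_const fun _ => Or.inr hp0.le
  have hAi : Integrable fun x => ballProfile 1 x ^ p * ‖gradient w x‖ ^ p :=
    integrable_of_continuous_of_eq_zero (hθc.mul hgc) (R := 1) fun x hx => by
      rw [ballProfile_eq_zero one_pos.le hx, Real.zero_rpow hp0.ne', zero_mul]
  have hA0 : ∀ x, 0 ≤ ballProfile 1 x ^ p * ‖gradient w x‖ ^ p := fun x =>
    mul_nonneg (Real.rpow_nonneg (ballProfile_nonneg 1 x) _) (Real.rpow_nonneg (norm_nonneg _) _)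
  have hi : IntegrableOn (fun x => ‖fderiv ℝ w x‖) (ball 0 (3 / 4)) :=
    (((hw1.continuous_fderiv one_ne_zero).norm.continuousOn).integrableOn_compact
      (isCompact_closedBall (0 : EuclideanSpace ℝ (Fin d)) _)).mono_set ball_subset_closedBall
  have h1 : ∫ x in ball 0 (3 / 4), ‖fderiv ℝ w x‖ ≤ ∫ x in ball 0 (3 / 4),
      (1 + (16 / 7) ^ p * (ballProfile 1 x ^ p * ‖gradient w x‖ ^ p)) := by
    refine setIntegral_mono_on hi ((integrableOn_const measure_ball_lt_top.ne).add
      ((hAi.const_mul _).integrableOn)) measurableSet_ball fun x hx => ?_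
    rw [mem_ball_zero_iff] at hx
    have ha : ‖fderiv ℝ w x‖ ≤ 1 + ‖gradient w x‖ ^ p := by
      rw [← norm_gradient]
      rcases le_total ‖gradient w x‖ 1 with h | h
      · have := Real.rpow_nonneg (norm_nonneg (gradient w x)) p
        linarith
      · have := Real.self_le_rpow_of_one_le h hp.le
        linarith
    have hθ : 1 ≤ 16 / 7 * ballProfile 1 x := by
      have : 7 / 16 ≤ ballProfile 1 x :=
        le_max_of_le_right (by nlinarith [norm_nonneg x])
      linarith
    have hθp : 1 ≤ (16 / 7) ^ p * ballProfile 1 x ^ p := by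
      rw [← Real.mul_rpow (by norm_num) (ballProfile_nonneg 1 x)]
      exact Real.one_le_rpow hθ hp0.le
    have := mul_le_mul_of_nonneg_right hθp (Real.rpow_nonneg (norm_nonneg (gradient w x)) p)
    linarith
  refine h1.trans ?_
  have hci : Integrable (fun _ : EuclideanSpace ℝ (Fin d) => (1 : ℝ))
      (volume.restrict (ball 0 (3 / 4))) := integrableOn_const measure_ball_lt_top.ne
  rw [integral_add hci ((hAi.const_mul _).integrableOn),
    integral_const_mul, setIntegral_const, smul_eq_mul, mul_one, add_mul, one_mul, mul_assoc]
  gcongr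
  · exact measure_ball_lt_top.ne
  · norm_num
  · exact (setIntegral_le_integral hAi (Eventually.of_forall hA0)).trans hcacc

/-- Logarithms of solutions have uniformly bounded mean oscillation on the ball of radius `3/4`. -/
theorem exists_oscillation_bound (hp : 1 < p) (hΛ : 0 ≤ Λ) :
    ∃ C : ℝ, 0 ≤ C ∧ ∀ w : EuclideanSpace ℝ (Fin d) → ℝ, IsLogSol p Λ w →
      ∃ m : ℝ, ∫ x in ball 0 (3 / 4), |w x - m| ≤ C := by
  have hp1 : 0 < p - 1 := by linarith
  have hp0 : 0 < p := by linarith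
  refine ⟨2 * (2 * (3 / 4) * (2 ^ d *
    ((1 + (16 / 7) ^ p * (2 / (p - 1) * (Λ + 2 * p * (4 * p / (p - 1)) ^ (p - 1)))) *
        volume.real (ball (0 : EuclideanSpace ℝ (Fin d)) 1)))), by positivity, fun w hw => ?_⟩
  obtain ⟨m, hm⟩ := exists_integral_abs_sub_le hw.1 (R := 3 / 4) (by norm_num)
  refine ⟨m, hm.trans ?_⟩
  gcongr
  exact hw.integral_norm_fderiv_le hp hΛ

end Poincare

section CrossOver

variable {d : ℕ} {p Λ : ℝ}

theorem exists_forall_two_mul_log_le {s : ℝ} (hs : 0 < s) :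
    ∃ φ₀ : ℝ, 1 < φ₀ ∧ ∀ φ, φ₀ ≤ φ → 2 * Real.log φ ≤ s * φ := by
  have h := Real.isLittleO_log_id_atTop.bound (half_pos hs)
  obtain ⟨A, hA⟩ := eventually_atTop.1 h
  refine ⟨max A 2, lt_max_of_lt_right one_lt_two, fun φ hφ => ?_⟩
  have h1 := hA φ ((le_max_left _ _).trans hφ)
  have h2 : 2 ≤ φ := (le_max_right _ _).trans hφ
  rw [id, Real.norm_eq_abs, Real.norm_of_nonneg (by linarith)] at h1
  linarith [le_abs_self (Real.log φ)]

theorem setIntegral_exp_mul_le {f : EuclideanSpace ℝ (Fin d) → ℝ} (hf : Continuous f)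
    {s φ σ C₁ : ℝ} (hs : 0 < s) (hφ : 1 < φ) (hsφ : s * φ ≤ 2 * Real.log φ) (hσ : σ ≤ 3 / 4)
    (hfφ : ∀ x ∈ ball 0 σ, f x ≤ φ) (hP : ∫ x in ball 0 (3 / 4), |f x| ≤ C₁) :
    ∫ x in ball 0 σ, Real.exp (s * f x) ≤
      (volume.real (ball (0 : EuclideanSpace ℝ (Fin d)) (3 / 4)) + 2 * C₁) *
        Real.exp (s * φ / 2) := by
  have hφ0 : 0 < φ := by linarith
  have hsub : ball (0 : EuclideanSpace ℝ (Fin d)) σ ⊆ ball 0 (3 / 4) := ball_subset_ball hσ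
  have hfi : IntegrableOn (fun x => |f x|) (ball 0 (3 / 4)) :=
    ((Continuous.continuousOn (by fun_prop)).integrableOn_compact
      (isCompact_closedBall (0 : EuclideanSpace ℝ (Fin d)) _)).mono_set ball_subset_closedBall
  have hci : Integrable (fun _ : EuclideanSpace ℝ (Fin d) => Real.exp (s * φ / 2))
      (volume.restrict (ball 0 (3 / 4))) := integrableOn_const measure_ball_lt_top.ne
  have hexp : Real.exp (s * φ) = Real.exp (s * φ / 2) * Real.exp (s * φ / 2) := by
    rw [← Real.exp_add]; ring_nf
  have hle : Real.exp (s * φ / 2) ≤ φ := by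
    rw [← Real.le_log_iff_exp_le hφ0]
    linarith
  have hE := Real.exp_pos (s * φ / 2)
  have hpt : ∀ x ∈ ball (0 : EuclideanSpace ℝ (Fin d)) σ, Real.exp (s * f x) ≤
      Real.exp (s * φ / 2) + 2 * Real.exp (s * φ / 2) * |f x| := by
    intro x hx
    rcases le_or_gt (f x) (φ / 2) with h | h
    · have h1 : Real.exp (s * f x) ≤ Real.exp (s * φ / 2) := Real.exp_le_exp.2 (by nlinarith)
      have := mul_nonneg (mul_nonneg two_pos.le hE.le) (abs_nonneg (f x))
      linarith
    · have h1 : Real.exp (s * f x) ≤ Real.exp (s * φ) :=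
        Real.exp_le_exp.2 (mul_le_mul_of_nonneg_left (hfφ x hx) hs.le)
      have h2 : Real.exp (s * φ / 2) ≤ 2 * |f x| := by
        linarith [le_abs_self (f x)]
      nlinarith [mul_le_mul_of_nonneg_left h2 hE.le]
  calc ∫ x in ball 0 σ, Real.exp (s * f x)
      ≤ ∫ x in ball 0 σ, (Real.exp (s * φ / 2) + 2 * Real.exp (s * φ / 2) * |f x|) :=
        setIntegral_mono_on (integrableOn_ball_exp hf s σ)
          ((hci.add (hfi.const_mul _)).mono_measure (Measure.restrict_mono_set _ hsub))
          measurableSet_ball hpt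
    _ ≤ ∫ x in ball 0 (3 / 4), (Real.exp (s * φ / 2) + 2 * Real.exp (s * φ / 2) * |f x|) :=
        setIntegral_mono_set (hci.add (hfi.const_mul _))
          (Eventually.of_forall fun x => by positivity) (LE.le.eventuallyLE hsub)
    _ = volume.real (ball (0 : EuclideanSpace ℝ (Fin d)) (3 / 4)) * Real.exp (s * φ / 2) +
          2 * Real.exp (s * φ / 2) * ∫ x in ball 0 (3 / 4), |f x| := by
        rw [integral_add hci (hfi.const_mul _), integral_const_mul, setIntegral_const, smul_eq_mul]
    _ ≤ _ := by nlinarith [mul_le_mul_of_nonneg_left hP hE.le]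

set_option maxHeartbeats 800000 in
/-- Reverse Hölder bounds along exponents tending to `0`, together with an `L¹` bound, imply an
upper bound in the interior. -/
theorem exists_upper_bound_of_grid (d : ℕ) {a s₀ ρ C₁ : ℝ} (K : ℝ) (ha : 0 < a) (hs₀ : 0 < s₀)
    (hρ : 0 < ρ) (hρ1 : ρ < 1) (hC₁ : 0 ≤ C₁) :
    ∃ C : ℝ, ∀ f : EuclideanSpace ℝ (Fin d) → ℝ, Continuous f →
      (∀ (n : ℕ) (x : EuclideanSpace ℝ (Fin d)) (σ : ℝ), ‖x‖ < σ → σ ≤ 1 →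
        s₀ * ρ ^ n * f x ≤ K - a * Real.log (σ - ‖x‖) +
          Real.log (∫ y in ball 0 σ, Real.exp (s₀ * ρ ^ n * f y))) →
      ∫ x in ball 0 (3 / 4), |f x| ≤ C₁ → ∀ x, ‖x‖ ≤ 1 / 2 → f x ≤ C := by
  obtain ⟨φ₀, hφ₀1, hφ₀⟩ := exists_forall_two_mul_log_le hs₀
  set c₁ := volume.real (ball (0 : EuclideanSpace ℝ (Fin d)) (3 / 4)) + 2 * C₁ with hc₁
  have hvol : 0 < volume.real (ball (0 : EuclideanSpace ℝ (Fin d)) (3 / 4)) :=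
    ENNReal.toReal_pos (measure_ball_pos volume _ (by norm_num)).ne' measure_ball_lt_top.ne
  have hc₁0 : 0 < c₁ := by positivity
  set b := a / (3 / 5 * ρ) with hb
  have hb0 : 0 < b := by positivity
  set ε := 1 - (4 / 5 : ℝ) ^ (1 / b) with hε
  have h45 : (4 / 5 : ℝ) ^ (1 / b) < 1 :=
    Real.rpow_lt_one (by norm_num) (by norm_num) (by positivity)
  have h450 : 0 < (4 / 5 : ℝ) ^ (1 / b) := by positivity
  have hε0 : 0 < ε := by linarith
  have hε1 : ε < 1 := by linarith
  have hεb : (1 - ε) ^ b = 4 / 5 := by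
    rw [hε, sub_sub_cancel, ← Real.rpow_mul (by norm_num), one_div_mul_cancel hb0.ne',
      Real.rpow_one]
  set K' := (K + Real.log c₁ - a * Real.log ε) / (3 / 5 * ρ) with hK'
  set H := max φ₀ (Real.exp K') with hH
  have hH0 : 0 < H := lt_max_of_lt_left (by linarith)
  refine ⟨4 ^ b * H, fun f hf hM hP => ?_⟩
  set h : EuclideanSpace ℝ (Fin d) → ℝ := fun x => (3 / 4 - ‖x‖) ^ b * f x with hh
  have hhc : Continuous h := by
    have : Continuous fun x : EuclideanSpace ℝ (Fin d) => (3 / 4 - ‖x‖) ^ b :=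
      (continuous_const.sub continuous_norm).rpow_const fun _ => Or.inr hb0.le
    exact this.mul hf
  obtain ⟨x₀, hx₀, hmax⟩ :=
    (isCompact_closedBall (0 : EuclideanSpace ℝ (Fin d)) (3 / 4)).exists_isMaxOn
    ⟨0, mem_closedBall_self (by norm_num)⟩ hhc.continuousOn
  have hmax' : ∀ y : EuclideanSpace ℝ (Fin d), ‖y‖ ≤ 3 / 4 → h y ≤ h x₀ := fun y hy =>
    hmax (mem_closedBall_zero_iff.2 hy)
  rw [mem_closedBall_zero_iff] at hx₀
  have hkey : h x₀ ≤ H := by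
    rcases le_or_gt (f x₀) 0 with hf0 | hf0
    · exact (mul_nonpos_of_nonneg_of_nonpos (Real.rpow_nonneg (by linarith) _) hf0).trans hH0.le
    rcases hx₀.eq_or_lt with hx₁ | hx₁
    · simp only [hh, hx₁, sub_self, Real.zero_rpow hb0.ne', zero_mul]
      exact hH0.le
    set D := 3 / 4 - ‖x₀‖ with hD
    have hD0 : 0 < D := sub_pos.2 hx₁
    have hn0 := norm_nonneg x₀
    have hD1 : D ≤ 1 := by linarith
    have hDb1 : D ^ b ≤ 1 := Real.rpow_le_one hD0.le hD1 hb0.le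
    set φ := 5 / 4 * f x₀ with hφ
    have hhx₀ : h x₀ = D ^ b * f x₀ := rfl
    rcases le_or_gt φ φ₀ with hφφ | hφφ
    · rw [hhx₀]
      refine le_trans ?_ (le_max_left _ _)
      nlinarith
    have hφ1 : 1 < φ := by linarith
    have hlogφ : 0 < Real.log φ := Real.log_pos hφ1
    set σ := ‖x₀‖ + ε * D with hσ
    have hσ34 : σ ≤ 3 / 4 := by nlinarith
    have hfφ : ∀ y ∈ ball (0 : EuclideanSpace ℝ (Fin d)) σ, f y ≤ φ := by
      intro y hy
      rw [mem_ball_zero_iff] at hy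
      rcases le_or_gt (f y) 0 with hy0 | hy0
      · linarith
      have h1 := hmax' y (by linarith)
      have h2 : (1 - ε) * D ≤ 3 / 4 - ‖y‖ := by linarith
      have h3 : 4 / 5 * D ^ b ≤ (3 / 4 - ‖y‖) ^ b := by
        rw [← hεb, ← Real.mul_rpow (by linarith) hD0.le]
        exact Real.rpow_le_rpow (mul_nonneg (by linarith) hD0.le) h2 hb0.le
      have h4 : 4 / 5 * D ^ b * f y ≤ D ^ b * f x₀ :=
        (mul_le_mul_of_nonneg_right h3 hy0.le).trans h1
      have h5 : D ^ b * (4 / 5 * f y) ≤ D ^ b * f x₀ := by linarith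
      have := le_of_mul_le_mul_left h5 (by positivity)
      linarith
    have hL0 : 0 < 2 * Real.log φ / (φ * s₀) := by positivity
    have hL1 : 2 * Real.log φ / (φ * s₀) ≤ 1 := by
      rw [div_le_one (by positivity)]
      linarith [hφ₀ φ hφφ.le]
    obtain ⟨n, hn1, hn2⟩ := exists_nat_pow_near_of_lt_one hL0 hL1 hρ hρ1
    set s := s₀ * ρ ^ (n + 1) with hs
    have hs0 : 0 < s := by positivity
    rw [lt_div_iff₀ (by positivity)] at hn1
    rw [div_le_iff₀ (by positivity)] at hn2
    have hsφ : s * φ ≤ 2 * Real.log φ := by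
      rw [hs]; linarith
    have hsφ' : ρ * (2 * Real.log φ) ≤ s * φ := by
      have := mul_le_mul_of_nonneg_left hn2 hρ.le
      rw [hs, pow_succ]; linarith
    have hI := setIntegral_exp_mul_le hf hs0 hφ1 hsφ hσ34 hfφ hP
    have hσx : ‖x₀‖ < σ := by
      have := mul_pos hε0 hD0
      linarith
    have hM1 := hM (n + 1) x₀ σ hσx (by linarith)
    rw [← hs] at hM1
    have hlog := Real.log_le_log (setIntegral_exp_pos hf s (hn0.trans_lt hσx)) hI
    rw [← hc₁, Real.log_mul hc₁0.ne' (Real.exp_pos _).ne', Real.log_exp] at hlog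
    rw [show σ - ‖x₀‖ = ε * D by rw [hσ]; ring, Real.log_mul hε0.ne' hD0.ne'] at hM1
    have hfx : f x₀ = 4 / 5 * φ := by rw [hφ]; ring
    rw [hfx] at hM1
    have h6 : 3 / 5 * ρ * Real.log φ ≤
        K + Real.log c₁ - a * Real.log ε - a * Real.log D := by
      nlinarith
    have h7 : Real.log φ + b * Real.log D ≤ K' := by
      rw [hK', le_div_iff₀ (by positivity)]
      have : b * (3 / 5 * ρ) = a := by
        rw [hb]; field_simp
      linear_combination h6 + Real.log D * this
    have h8 : φ * D ^ b ≤ Real.exp K' := by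
      rw [← Real.log_le_iff_le_exp (by positivity), Real.log_mul (by linarith) (by positivity),
        Real.log_rpow hD0]
      exact h7
    rw [hhx₀, hfx]
    refine le_trans ?_ (le_max_right _ _)
    have : 0 < φ * D ^ b := by positivity
    linarith
  intro x hx
  rcases le_or_gt (f x) 0 with h0 | h0
  · exact h0.trans (by positivity)
  have h1 : (4 : ℝ)⁻¹ ^ b * f x ≤ H := by
    refine le_trans ?_ ((hmax' x (by linarith)).trans hkey)
    refine mul_le_mul_of_nonneg_right ?_ h0.le
    exact Real.rpow_le_rpow (by norm_num) (by linarith) hb0.le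
  rw [Real.inv_rpow (by norm_num)] at h1
  have h2 : (0 : ℝ) < 4 ^ b := by positivity
  calc f x = 4 ^ b * ((4 ^ b)⁻¹ * f x) := by field_simp
    _ ≤ _ := by gcongr

/-- The Harnack inequality in logarithmic form on the unit ball. -/
theorem exists_sub_le (hd : 2 ≤ d) (hp : 1 < p) (hΛ : 0 ≤ Λ) :
    ∃ C : ℝ, ∀ w : EuclideanSpace ℝ (Fin d) → ℝ, IsLogSol p Λ w →
      ∀ x y, ‖x‖ ≤ 1 / 2 → ‖y‖ ≤ 1 / 2 → w x - w y ≤ C := by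
  obtain ⟨K, a, s₀, ρ, ha, hs₀, hρ, hρ1, H⟩ := exists_moser_bound_grid (d := d) hd hp hΛ
  obtain ⟨C₁, hC₁, hosc⟩ := exists_oscillation_bound (d := d) hp hΛ
  obtain ⟨C, hC⟩ := exists_upper_bound_of_grid d K ha hs₀ hρ hρ1 hC₁
  refine ⟨C + C, fun w hw x y hx hy => ?_⟩
  obtain ⟨m, hm⟩ := hosc w hw
  have hwc := hw.1.continuous
  have key : ∀ e : ℝ, (e = 1 ∨ e = -1) → ∀ z, ‖z‖ ≤ 1 / 2 → e * (w z - m) ≤ C := by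
    intro e he
    refine hC (fun z => e * (w z - m)) (by fun_prop) (fun n z σ hz hσ => ?_) ?_
    · have h1 := H w hw e he n z σ hz hσ
      set s := s₀ * ρ ^ n
      have h2 : ∀ y, Real.exp (s * (e * w y)) =
          Real.exp (s * (e * m)) * Real.exp (s * (e * (w y - m))) := fun y => by
        rw [← Real.exp_add]; ring_nf
      simp only [h2] at h1
      have h3 : 0 < ∫ y in ball 0 σ, Real.exp (s * (e * (w y - m))) :=
        setIntegral_exp_pos (w := fun y => e * (w y - m)) (by fun_prop) s
          ((norm_nonneg z).trans_lt hz)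
      rw [integral_const_mul, Real.log_mul (Real.exp_pos _).ne' h3.ne', Real.log_exp] at h1
      linarith
    · have : ∀ z, |e * (w z - m)| = |w z - m| := fun z => by
        rcases he with rfl | rfl <;> simp [abs_sub_comm]
      simpa only [this] using hm
  have h1 := key 1 (Or.inl rfl) x hx
  have h2 := key (-1) (Or.inr rfl) y hy
  linarith

end CrossOver

section Chain

variable {d : ℕ}

theorem exists_orthogonal_norm_eq (hd : 2 ≤ d) (x y : EuclideanSpace ℝ (Fin d)) {s : ℝ}
    (hs : 0 ≤ s) : ∃ z : EuclideanSpace ℝ (Fin d), ‖z‖ = s ∧ ⟪x, z⟫ = 0 ∧ 0 ≤ ⟪z, y⟫ := by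
  have hne : (Submodule.span ℝ {x})ᗮ ≠ ⊥ := by
    intro h
    rw [Submodule.orthogonal_eq_bot_iff] at h
    have h1 := finrank_span_le_card (R := ℝ) ({x} : Set (EuclideanSpace ℝ (Fin d)))
    rw [h, finrank_top, finrank_euclideanSpace_fin] at h1
    simp at h1
    omega
  obtain ⟨v, hv, hv0⟩ := Submodule.exists_mem_ne_zero_of_ne_bot hne
  rw [Submodule.mem_orthogonal_singleton_iff_inner_right] at hv
  have hn : 0 < ‖v‖ := norm_pos_iff.2 hv0
  have key : ∀ e : ℝ, |e| = 1 → ‖(e * (s / ‖v‖)) • v‖ = s ∧ ⟪x, (e * (s / ‖v‖)) • v⟫ = 0 := by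
    intro e he
    refine ⟨?_, by rw [inner_smul_right, hv, mul_zero]⟩
    rw [norm_smul, norm_mul, Real.norm_eq_abs, he, one_mul, Real.norm_of_nonneg (by positivity),
      div_mul_cancel₀ _ hn.ne']
  rcases le_total 0 ⟪v, y⟫ with h | h
  · refine ⟨(1 * (s / ‖v‖)) • v, (key 1 abs_one).1, (key 1 abs_one).2, ?_⟩
    rw [real_inner_smul_left]
    positivity
  · have h1 : |(-1 : ℝ)| = 1 := by simp
    refine ⟨(-1 * (s / ‖v‖)) • v, (key _ h1).1, (key _ h1).2, ?_⟩
    rw [real_inner_smul_left]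
    have : 0 ≤ s / ‖v‖ := by positivity
    nlinarith

theorem abs_sub_le_of_inner_nonneg {g : EuclideanSpace ℝ (Fin d) → ℝ} {C r : ℝ} (hr : 0 < r)
    (hr2 : r < 1 / 2)
    (hg : ∀ a b, 0 < ‖a‖ → ‖a‖ < 1 / 2 → ‖b - a‖ ≤ ‖a‖ / 4 → |g a - g b| ≤ C)
    {x y : EuclideanSpace ℝ (Fin d)} (hx : r / 2 < ‖x‖ ∧ ‖x‖ < r) (hy : r / 2 < ‖y‖ ∧ ‖y‖ < r)
    (hxy : 0 ≤ ⟪x, y⟫) : |g x - g y| ≤ 32 * C := by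
  set z : ℕ → EuclideanSpace ℝ (Fin d) := fun i => x + ((i : ℝ) / 32) • (y - x) with hz
  have hnorm : ∀ i : ℕ, i ≤ 32 → r / 4 ≤ ‖z i‖ ∧ ‖z i‖ < 1 / 2 := by
    intro i hi
    set t := (i : ℝ) / 32 with ht
    have ht0 : 0 ≤ t := by positivity
    have ht1 : t ≤ 1 := by
      rw [ht, div_le_one (by norm_num)]
      exact_mod_cast hi
    have hzi : z i = (1 - t) • x + t • y := by
      simp only [hz, ← ht]
      module
    have h1 : ‖z i‖ ^ 2 = (1 - t) ^ 2 * ‖x‖ ^ 2 + 2 * ((1 - t) * t * ⟪x, y⟫) + t ^ 2 * ‖y‖ ^ 2 := by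
      rw [hzi, norm_add_sq_real, norm_smul, norm_smul, real_inner_smul_left, inner_smul_right,
        Real.norm_of_nonneg ht0, Real.norm_of_nonneg (by linarith)]
      ring
    constructor
    · refine (sq_le_sq₀ (by positivity) (norm_nonneg _)).1 ?_
      have h2 : 0 ≤ (1 - t) * t * ⟪x, y⟫ := mul_nonneg (mul_nonneg (by linarith) ht0) hxy
      have h3 : (r / 2) ^ 2 ≤ ‖x‖ ^ 2 := by gcongr; exact hx.1.le
      have h4 : (r / 2) ^ 2 ≤ ‖y‖ ^ 2 := by gcongr; exact hy.1.le
      have h5 := mul_le_mul_of_nonneg_left h3 (sq_nonneg (1 - t))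
      have h6 := mul_le_mul_of_nonneg_left h4 (sq_nonneg t)
      have h7 : 1 / 4 ≤ (1 - t) ^ 2 + t ^ 2 := by nlinarith [sq_nonneg (1 - 2 * t)]
      have h8 := mul_le_mul_of_nonneg_right h7 (sq_nonneg (r / 2))
      rw [h1]
      linarith
    · have h2 := (convex_ball (0 : EuclideanSpace ℝ (Fin d)) r) (mem_ball_zero_iff.2 hx.2)
        (mem_ball_zero_iff.2 hy.2) (by linarith : 0 ≤ 1 - t) ht0 (by ring)
      rw [← hzi, mem_ball_zero_iff] at h2
      linarith
  have hstep : ∀ i : ℕ, ‖z (i + 1) - z i‖ ≤ r / 16 := by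
    intro i
    have h1 : z (i + 1) - z i = (1 / 32 : ℝ) • (y - x) := by
      simp only [hz]
      push_cast
      module
    rw [h1, norm_smul, Real.norm_of_nonneg (by norm_num)]
    linarith [norm_sub_le y x]
  have hind : ∀ i : ℕ, i ≤ 32 → |g x - g (z i)| ≤ i * C := by
    intro i
    induction i with
    | zero => simp [hz]
    | succ i ih =>
      intro hi
      have h1 := ih (by omega)
      have h2 := hnorm i (by omega)
      have h3 := hg (z i) (z (i + 1)) (by linarith) h2.2 (by linarith [hstep i])
      have h4 := abs_sub_le (g x) (g (z i)) (g (z (i + 1)))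
      push_cast
      linarith
  have h := hind 32 le_rfl
  have h32 : z 32 = y := by simp [hz]
  rw [h32] at h
  exact_mod_cast h

theorem abs_sub_le_of_mem_annulus (hd : 2 ≤ d) {g : EuclideanSpace ℝ (Fin d) → ℝ} {C r : ℝ}
    (hr : 0 < r) (hr2 : r < 1 / 2)
    (hg : ∀ a b, 0 < ‖a‖ → ‖a‖ < 1 / 2 → ‖b - a‖ ≤ ‖a‖ / 4 → |g a - g b| ≤ C)
    {x y : EuclideanSpace ℝ (Fin d)} (hx : r / 2 < ‖x‖ ∧ ‖x‖ < r) (hy : r / 2 < ‖y‖ ∧ ‖y‖ < r) :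
    |g x - g y| ≤ 64 * C := by
  obtain ⟨z, hz, hxz, hzy⟩ := exists_orthogonal_norm_eq hd x y (s := 3 / 4 * r) (by positivity)
  have hzr : r / 2 < ‖z‖ ∧ ‖z‖ < r := by
    rw [hz]
    constructor <;> linarith
  have h1 := abs_sub_le_of_inner_nonneg hr hr2 hg hx hzr hxz.ge
  have h2 := abs_sub_le_of_inner_nonneg hr hr2 hg hzr hy hzy
  linarith [abs_sub_le (g x) (g z) (g y)]

/-- The interior Harnack inequality on balls whose radius is comparable to the distance to `0`. -/
theorem exists_abs_log_sub_le (hd : 2 ≤ d) {p C₀ : ℝ} (hp : 1 < p) (hC₀ : 0 ≤ C₀) :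
    ∃ C : ℝ, ∀ V : EuclideanSpace ℝ (Fin d) → ℝ, Measurable V →
      (∀ K : Set (EuclideanSpace ℝ (Fin d)), IsCompact K →
        K ⊆ ball (0 : EuclideanSpace ℝ (Fin d)) 1 \ {0} → ∃ M : ℝ, ∀ x ∈ K, |V x| ≤ M) →
      (∀ᵐ x ∂(volume.restrict (ball (0 : EuclideanSpace ℝ (Fin d)) 1 \ {0})),
        ‖x‖ ^ p * |V x| ≤ C₀) →
      ∀ u : EuclideanSpace ℝ (Fin d) → ℝ,
        IsPosWeakSol p V (ball (0 : EuclideanSpace ℝ (Fin d)) 1 \ {0}) u →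
        ∀ a b, 0 < ‖a‖ → ‖a‖ < 1 / 2 → ‖b - a‖ ≤ ‖a‖ / 4 →
          |Real.log (u a) - Real.log (u b)| ≤ C := by
  obtain ⟨C, hC⟩ := exists_sub_le (d := d) hd hp hC₀
  refine ⟨C, fun V hV hVb hVC u hu a b ha0 ha hab => ?_⟩
  obtain ⟨w, hw, hwu⟩ := hu.exists_isLogSol hp hV hVb hVC ha0 ha
  set x := (‖a‖ / 2)⁻¹ • (b - a) with hx
  have hx2 : ‖x‖ ≤ 1 / 2 := by
    rw [hx, norm_smul, norm_inv, Real.norm_of_nonneg (by positivity),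
      inv_mul_le_iff₀ (by positivity)]
    linarith
  have h0 : ‖(0 : EuclideanSpace ℝ (Fin d))‖ ≤ 1 / 2 := by simp
  have e0 := hwu 0 (h0.trans (by norm_num))
  have e1 := hwu x (hx2.trans (by norm_num))
  rw [smul_zero, add_zero] at e0
  rw [hx, smul_inv_smul₀ (by positivity), add_sub_cancel, ← hx] at e1
  rw [← e0, ← e1, abs_sub_le_iff]
  exact ⟨hC w hw 0 x h0 hx2, hC w hw x 0 hx2 h0⟩

end Chain

theorem stmt9 (d : ℕ) (hd : 2 ≤ d) (p : ℝ) (hp : 1 < p) (C₀ : ℝ) (hC₀ : 0 < C₀) :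
    ∃ C : ℝ, 0 < C ∧
      ∀ V : EuclideanSpace ℝ (Fin d) → ℝ, Measurable V →
        (∀ K : Set (EuclideanSpace ℝ (Fin d)), IsCompact K →
          K ⊆ ball (0 : EuclideanSpace ℝ (Fin d)) 1 \ {0} → ∃ M : ℝ, ∀ x ∈ K, |V x| ≤ M) →
        (∀ᵐ x ∂(volume.restrict (ball (0 : EuclideanSpace ℝ (Fin d)) 1 \ {0})),
          ‖x‖ ^ p * |V x| ≤ C₀) →
        ∀ u v : EuclideanSpace ℝ (Fin d) → ℝ,
          IsPosWeakSol p V (ball (0 : EuclideanSpace ℝ (Fin d)) 1 \ {0}) u →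
          IsPosWeakSol p V (ball (0 : EuclideanSpace ℝ (Fin d)) 1 \ {0}) v →
          ∀ r : ℝ, 0 < r → r < 1 / 2 →
            ∀ x ∈ {y : EuclideanSpace ℝ (Fin d) | r / 2 < ‖y‖ ∧ ‖y‖ < r},
              ∀ y ∈ {y : EuclideanSpace ℝ (Fin d) | r / 2 < ‖y‖ ∧ ‖y‖ < r},
                u x / v x ≤ C * (u y / v y) := by
  obtain ⟨C, hC⟩ := exists_abs_log_sub_le hd hp hC₀.le
  refine ⟨Real.exp (128 * C), Real.exp_pos _, fun V hV hVb hVC u v hu hv r hr hr2 x hx y hy => ?_⟩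
  have hmem : ∀ {z : EuclideanSpace ℝ (Fin d)}, r / 2 < ‖z‖ ∧ ‖z‖ < r →
      z ∈ ball (0 : EuclideanSpace ℝ (Fin d)) 1 \ {0} := fun {z} hz => by
    refine ⟨mem_ball_zero_iff.2 (by linarith [hz.2]), fun h => ?_⟩
    rw [mem_singleton_iff.1 h, norm_zero] at hz
    linarith [hz.1]
  have hux := hu.2.1 x (hmem hx)
  have huy := hu.2.1 y (hmem hy)
  have hvx := hv.2.1 x (hmem hx)
  have hvy := hv.2.1 y (hmem hy)
  have h1 := abs_sub_le_of_mem_annulus hd hr hr2 (hC V hV hVb hVC u hu) hx hy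
  have h2 := abs_sub_le_of_mem_annulus hd hr hr2 (hC V hV hVb hVC v hv) hx hy
  rw [← Real.log_le_log_iff (by positivity) (by positivity),
    Real.log_mul (Real.exp_pos _).ne' (by positivity), Real.log_exp,
    Real.log_div hux.ne' hvx.ne', Real.log_div huy.ne' hvy.ne']
  linarith [(abs_sub_le_iff.1 h1).1, (abs_sub_le_iff.1 h2).2]
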